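/- arXiv:2005.14384 — 3 statements merged into one kernel-verified Lean document; each statement's English description precedes it below -/
import Mathlib

section
/- For every integer r ≥ 3 there exists n₀ such that for all n > n₀ the following holds: for every set A ⊆ [n] with |A| ≥ (1 - r^{-3})·n, the number of rainbow sum-free r-colorings of A satisfies g(A, r) ≤ C(r,2)·2^{|A|} + 2^{-n/(26·log₂ n)}·2^{n}. -/
open Finset

/-- The number of rainbow sum-free `r`-colorings of a finite set `A` of positive
integers: colorings `f : A → Fin r` such that no Schur triple `x + y = z` inside `A`
receives three pairwise distinct colors. -/
noncomputable def numRSF (r : ℕ) (A : Finset ℕ) : ℕ :=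
  Nat.card {f : ↥A → Fin r //
    ∀ x y z : ↥A, (x : ℕ) + (y : ℕ) = (z : ℕ) →
      ¬(f x ≠ f y ∧ f x ≠ f z ∧ f y ≠ f z)}

open Filter Topology

/-- One of the three numbers is the sum of the other two. -/
def SchurRel (x y z : ℕ) : Prop := x + y = z ∨ x + z = y ∨ y + z = x

/-- No Schur triple in `A` is rainbow under `f`. -/
def RainbowSumFree {r : ℕ} (A : Finset ℕ) (f : ℕ → Fin r) : Prop :=
  ∀ x ∈ A, ∀ y ∈ A, ∀ z ∈ A, SchurRel x y z → f x = f y ∨ f x = f z ∨ f y = f z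

section Counting

lemma card_le_prod_card {r : ℕ} (F : Finset (ℕ → Fin r)) (R : Finset ℕ)
    (L : ℕ → Finset (Fin r)) (hL : ∀ f ∈ F, ∀ v ∈ R, f v ∈ L v)
    (hinj : ∀ f ∈ F, ∀ g ∈ F, (∀ v ∈ R, f v = g v) → f = g) :
    #F ≤ ∏ v ∈ R, #(L v) := by
  rw [← Finset.card_pi]
  refine Finset.card_le_card_of_injOn (fun f v _ => f v) ?_ ?_
  · intro f hf
    simp only [Finset.mem_coe, Finset.mem_pi]
    exact fun v hv => hL f hf v hv
  · intro f hf g hg h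
    refine hinj f hf g hg fun v hv => ?_
    exact congrFun (congrFun h v) hv

lemma card_le_sum_card_filter {α ι : Type*} (F : Finset α) (I : Finset ι) (P : ι → α → Prop)
    [∀ i, DecidablePred (P i)] (h : ∀ f ∈ F, ∃ i ∈ I, P i f) :
    #F ≤ ∑ i ∈ I, #(F.filter (P i)) := by
  classical
  refine le_trans (Finset.card_le_card ?_) Finset.card_biUnion_le
  intro f hf
  obtain ⟨i, hi, hP⟩ := h f hf
  exact Finset.mem_biUnion.2 ⟨i, hi, Finset.mem_filter.2 ⟨hf, hP⟩⟩

lemma exists_sum_small_subsets_le (q κ : ℝ) (hq : 1 ≤ q) (hκ : 0 < κ) :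
    ∃ η : ℝ, 0 < η ∧ η ≤ 1 ∧ ∀ n : ℕ, ∀ X : Finset ℕ, #X ≤ n →
      ∑ E ∈ X.powerset with (#E : ℝ) ≤ η * n, q ^ #E ≤ (2 : ℝ) ^ (κ * n) := by
  set x : ℝ := min 1 ((2 : ℝ) ^ (κ / 2) - 1) with hx
  have h1 : (1 : ℝ) < 2 ^ (κ / 2) := Real.one_lt_rpow (by norm_num) (by linarith)
  have hx0 : 0 < x := lt_min one_pos (by linarith)
  have hx1 : x ≤ 1 := min_le_left _ _
  have hx2 : 1 + x ≤ 2 ^ (κ / 2) := by linarith [min_le_right 1 ((2 : ℝ) ^ (κ / 2) - 1)]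
  have hqx : 1 ≤ q / x := by rw [le_div_iff₀ hx0]; linarith
  have hlog : 0 ≤ Real.logb 2 (q / x) := Real.logb_nonneg (by norm_num) hqx
  set η : ℝ := min 1 ((κ / 2) / (Real.logb 2 (q / x) + 1)) with hη
  have hη0 : 0 < η := lt_min one_pos (by positivity)
  refine ⟨η, hη0, min_le_left _ _, fun n X hX => ?_⟩
  have hη2 : η * Real.logb 2 (q / x) ≤ κ / 2 := by
    have h2 : η ≤ (κ / 2) / (Real.logb 2 (q / x) + 1) := min_le_right _ _
    rw [le_div_iff₀ (by positivity)] at h2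
    nlinarith
  have hterm : ∀ E ∈ X.powerset.filter (fun E => (#E : ℝ) ≤ η * n),
      q ^ #E ≤ x ^ #E * (q / x) ^ (η * n) := by
    intro E hE
    have hE2 := (Finset.mem_filter.1 hE).2
    have : q ^ #E = x ^ #E * (q / x) ^ #E := by
      rw [← mul_pow]; congr 1; field_simp
    rw [this]
    gcongr
    rw [← Real.rpow_natCast]
    exact Real.rpow_le_rpow_of_exponent_le hqx hE2
  calc _ ≤ ∑ E ∈ X.powerset with (#E : ℝ) ≤ η * n, x ^ #E * (q / x) ^ (η * n) :=
        Finset.sum_le_sum hterm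
    _ ≤ ∑ E ∈ X.powerset, x ^ #E * (q / x) ^ (η * n) := by
        refine Finset.sum_le_sum_of_subset_of_nonneg (Finset.filter_subset _ _) ?_
        intros; positivity
    _ = (1 + x) ^ #X * (q / x) ^ (η * n) := by
        rw [← Finset.sum_mul]
        congr 1
        have := Finset.sum_pow_mul_eq_add_pow x 1 X
        simp only [one_pow, mul_one] at this
        rw [this, add_comm]
    _ ≤ (2 : ℝ) ^ (κ / 2 * n) * 2 ^ (κ / 2 * n) := by
        gcongr
        · calc (1 + x) ^ #X ≤ (1 + x) ^ n := pow_le_pow_right₀ (by linarith) hX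
            _ ≤ ((2 : ℝ) ^ (κ / 2)) ^ n := by gcongr
            _ = _ := by rw [← Real.rpow_natCast, ← Real.rpow_mul (by norm_num)]
        · have : q / x = (2 : ℝ) ^ (Real.logb 2 (q / x)) :=
            (Real.rpow_logb (by norm_num) (by norm_num) (by positivity)).symm
          rw [this, ← Real.rpow_mul (by norm_num)]
          refine Real.rpow_le_rpow_of_exponent_le (by norm_num) ?_
          have hn : (0 : ℝ) ≤ n := Nat.cast_nonneg n
          nlinarith
    _ = (2 : ℝ) ^ (κ * n) := by
        rw [← Real.rpow_add (by norm_num)]; congr 1; ring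

lemma exists_tuple_hitting {ι Ω : Type*} [Fintype Ω] [DecidableEq Ω] (I : Finset ι)
    (H : ι → Finset Ω) (q : ℝ) (K : ℕ) (hΩ : 0 < Fintype.card Ω)
    (hmiss : ∀ i ∈ I, (#(H i)ᶜ : ℝ) ≤ q * Fintype.card Ω) (hK : #I * q ^ K < 1) :
    ∃ ω : Fin K → Ω, ∀ i ∈ I, ∃ k, ω k ∈ H i := by
  by_contra! hcon
  have hsub : (Finset.univ : Finset (Fin K → Ω)) ⊆
      I.biUnion fun i => Fintype.piFinset fun _ => (H i)ᶜ := by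
    intro ω _
    obtain ⟨i, hi, h⟩ := hcon ω
    exact Finset.mem_biUnion.2 ⟨i, hi, by simpa [Fintype.mem_piFinset] using h⟩
  have hcard := (Finset.card_le_card hsub).trans Finset.card_biUnion_le
  simp only [Finset.card_univ, Fintype.card_pi, Finset.prod_const, Fintype.card_piFinset,
    Fintype.card_fin] at hcard
  have hcard' : (Fintype.card Ω : ℝ) ^ K ≤ ∑ i ∈ I, (#(H i)ᶜ : ℝ) ^ K := by exact_mod_cast hcard
  have hle : ∑ i ∈ I, (#(H i)ᶜ : ℝ) ^ K ≤ #I * (q * Fintype.card Ω) ^ K := by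
    rw [← nsmul_eq_mul]
    exact Finset.sum_le_card_nsmul _ _ _ fun i hi =>
      pow_le_pow_left₀ (Nat.cast_nonneg _) (hmiss i hi) K
  have hpos : (0 : ℝ) < (Fintype.card Ω : ℝ) ^ K := by positivity
  rw [mul_pow] at hle
  nlinarith

end Counting

section Hitting

lemma card_fiber_le_three (v k a b : ℕ) (Q : Finset (ℕ × ℕ))
    (hQ : ∀ p ∈ Q, SchurRel v p.1 p.2) :
    #(Q.filter fun p => (p.2 / k, p.1 % k) = (a, b)) ≤ 3 := by
  have aux : ∀ y w y' w' : ℕ, y % k = b → y' % k = b → w / k = a → w' / k = a →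
      ((v + y = w ∧ v + y' = w') ∨ (v + w = y ∧ v + w' = y') ∨ (y + w = v ∧ y' + w' = v)) →
      y = y' ∧ w = w' := by
    intro y w y' w' h1 h2 h3 h4 h
    have hy := Nat.div_add_mod y k
    have hy' := Nat.div_add_mod y' k
    have hw := Nat.div_add_mod w k
    have hw' := Nat.div_add_mod w' k
    rw [h1] at hy
    rw [h2] at hy'
    rw [h3] at hw
    rw [h4] at hw'
    rcases Nat.eq_zero_or_pos k with rfl | hk
    · simp only [Nat.mod_zero] at h1 h2
      omega
    have l1 := Nat.mod_lt w hk
    have l2 := Nat.mod_lt w' hk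
    rcases lt_trichotomy (y / k) (y' / k) with hlt | heq | hlt
    · exfalso
      have := Nat.mul_le_mul_left k (Nat.succ_le_of_lt hlt)
      rw [Nat.mul_succ] at this
      omega
    · rw [heq] at hy
      omega
    · exfalso
      have := Nat.mul_le_mul_left k (Nat.succ_le_of_lt hlt)
      rw [Nat.mul_succ] at this
      omega
  set S := Q.filter fun p => (p.2 / k, p.1 % k) = (a, b) with hS
  have hsub : S ⊆ (S.filter fun p => v + p.1 = p.2) ∪
      ((S.filter fun p => v + p.2 = p.1) ∪ (S.filter fun p => p.1 + p.2 = v)) := by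
    intro p hp
    have := hQ p (Finset.mem_filter.1 hp).1
    simp only [Finset.mem_union, Finset.mem_filter, hp, true_and]
    exact this
  have hmem : ∀ p ∈ S, p.2 / k = a ∧ p.1 % k = b := fun p hp => by
    simpa using (Finset.mem_filter.1 hp).2
  have c1 : #(S.filter fun p => v + p.1 = p.2) ≤ 1 := by
    refine Finset.card_le_one.2 fun p hp p' hp' => ?_
    rw [Finset.mem_filter] at hp hp'
    have h := hmem p hp.1
    have h' := hmem p' hp'.1
    exact Prod.ext_iff.2 (aux _ _ _ _ h.2 h'.2 h.1 h'.1 (Or.inl ⟨hp.2, hp'.2⟩))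
  have c2 : #(S.filter fun p => v + p.2 = p.1) ≤ 1 := by
    refine Finset.card_le_one.2 fun p hp p' hp' => ?_
    rw [Finset.mem_filter] at hp hp'
    have h := hmem p hp.1
    have h' := hmem p' hp'.1
    exact Prod.ext_iff.2 (aux _ _ _ _ h.2 h'.2 h.1 h'.1 (Or.inr (Or.inl ⟨hp.2, hp'.2⟩)))
  have c3 : #(S.filter fun p => p.1 + p.2 = v) ≤ 1 := by
    refine Finset.card_le_one.2 fun p hp p' hp' => ?_
    rw [Finset.mem_filter] at hp hp'
    have h := hmem p hp.1
    have h' := hmem p' hp'.1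
    exact Prod.ext_iff.2 (aux _ _ _ _ h.2 h'.2 h.1 h'.1 (Or.inr (Or.inr ⟨hp.2, hp'.2⟩)))
  have := Finset.card_le_card hsub
  have u1 := Finset.card_union_le (S.filter fun p => v + p.1 = p.2)
    ((S.filter fun p => v + p.2 = p.1) ∪ (S.filter fun p => p.1 + p.2 = v))
  have u2 := Finset.card_union_le (S.filter fun p => v + p.2 = p.1)
    (S.filter fun p => p.1 + p.2 = v)
  omega

/-- The part of `A` in a block of length `k` together with a residue class modulo `k`. -/
def blockResidue (A : Finset ℕ) (k a b : ℕ) : Finset ℕ :=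
  A.filter fun y => y / k = a ∨ y % k = b

lemma card_blockResidue_le {n k a b : ℕ} {A : Finset ℕ} (hA : A ⊆ Finset.Icc 1 n) (hk : 0 < k) :
    #(blockResidue A k a b) ≤ k + (n / k + 1) := by
  have h1 : #(A.filter fun y => y / k = a) ≤ k := by
    calc #(A.filter fun y => y / k = a) ≤ #(Finset.Ico (a * k) (a * k + k)) := by
          refine Finset.card_le_card fun y hy => ?_
          have h := (Finset.mem_filter.1 hy).2
          rw [Finset.mem_Ico]
          have e := Nat.div_add_mod y k
          have l := Nat.mod_lt y hk
          rw [h, mul_comm] at e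
          omega
      _ = k := by simp
  have h2 : #(A.filter fun y => y % k = b) ≤ n / k + 1 := by
    calc #(A.filter fun y => y % k = b) ≤ #(Finset.range (n / k + 1)) := by
          refine Finset.card_le_card_of_injOn (fun y => y / k) ?_ ?_
          · intro y hy
            have h := hA (Finset.mem_filter.1 hy).1
            rw [Finset.mem_Icc] at h
            simp only [Finset.coe_range, Set.mem_Iio]
            exact Nat.lt_succ_of_le (Nat.div_le_div_right h.2)
          · intro y hy y' hy' h
            have hb := (Finset.mem_filter.1 hy).2
            have hb' := (Finset.mem_filter.1 hy').2
            have e := Nat.div_add_mod y k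
            have e' := Nat.div_add_mod y' k
            simp only at h
            rw [h] at e
            omega
      _ = n / k + 1 := by simp
  have : blockResidue A k a b =
      (A.filter fun y => y / k = a) ∪ (A.filter fun y => y % k = b) := by
    rw [blockResidue, Finset.filter_or]
  rw [this]
  exact (Finset.card_union_le _ _).trans (by omega)

lemma exists_small_hitting_set (δ η : ℝ) (hδ : 0 < δ) (hδ1 : δ ≤ 1) (hη : 0 < η) (C : ℕ) :
    ∃ n₀ : ℕ, ∀ n : ℕ, n₀ ≤ n → ∀ A ⊆ Finset.Icc 1 n, ∀ {ι : Type} (I : Finset ι),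
      #I ≤ C * n → ∀ (v : ι → ℕ) (Q : ι → Finset (ℕ × ℕ)),
      (∀ i ∈ I, ∀ p ∈ Q i, p.1 ∈ A ∧ p.2 ∈ A ∧ SchurRel (v i) p.1 p.2) →
      (∀ i ∈ I, δ * n ≤ #(Q i)) →
      ∃ T ⊆ A, (#T : ℝ) ≤ η * n ∧ ∀ i ∈ I, ∃ p ∈ Q i, p.1 ∈ T ∧ p.2 ∈ T := by
  obtain ⟨J, hJ⟩ := exists_nat_ge (5 / η)
  have hJ0 : 0 < J := by
    have : (0 : ℝ) < J := lt_of_lt_of_le (by positivity) hJ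
    exact_mod_cast this
  set q : ℝ := 1 - δ / 6 with hq
  have hq0 : 0 < q := by rw [hq]; linarith
  have hq1 : q < 1 := by rw [hq]; linarith
  have hlim : Tendsto (fun K : ℕ => (4 * C * J ^ 2 : ℝ) * ((K : ℝ) ^ 2 * q ^ K)) atTop (𝓝 0) := by
    have := (tendsto_pow_const_mul_const_pow_of_abs_lt_one 2
      (by rw [abs_of_pos hq0]; exact hq1 : |q| < 1)).const_mul (4 * C * J ^ 2 : ℝ)
    simpa using this
  obtain ⟨K₀, hK₀⟩ := Filter.eventually_atTop.1 (hlim.eventually (gt_mem_nhds one_pos))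
  refine ⟨(J * (K₀ + 1)) ^ 2, fun n hn A hA ι I hI v Q hQ hQc => ?_⟩
  set k := Nat.sqrt n with hk
  have hkJ : J * (K₀ + 1) ≤ k := by
    rw [hk, Nat.le_sqrt']; exact hn
  have hk0 : 0 < k := lt_of_lt_of_le (Nat.mul_pos hJ0 (Nat.succ_pos _)) hkJ
  set K := k / J with hK
  have hKK : K₀ + 1 ≤ K := by
    rw [hK, Nat.le_div_iff_mul_le hJ0, mul_comm]; exact hkJ
  have hkn : k * k ≤ n := Nat.sqrt_le n
  have hnk : n < (k + 1) * (k + 1) := Nat.lt_succ_sqrt n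
  have hkK : k + 1 ≤ J * (K + 1) := by
    have := Nat.lt_mul_div_succ k hJ0
    exact this
  have hk_le_n : k ≤ n := Nat.sqrt_le_self n
  have hn0 : 0 < n := lt_of_lt_of_le hk0 hk_le_n
  have hnkdiv : n / k ≤ k + 2 := by
    rw [← Nat.lt_succ_iff, Nat.div_lt_iff_lt_mul hk0]
    nlinarith
  let H : ι → Finset (Fin (n / k + 1) × Fin k) := fun i =>
    Finset.univ.filter fun ω => ∃ p ∈ Q i, p.2 / k = ω.1.1 ∧ p.1 % k = ω.2.1
  have hΩ : Fintype.card (Fin (n / k + 1) × Fin k) = (n / k + 1) * k := by simp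
  have hΩ2 : (n / k + 1) * k ≤ 2 * n := by
    have := Nat.div_mul_le_self n k
    rw [add_mul, one_mul]; omega
  have hH : ∀ i ∈ I, #(Q i) ≤ 3 * #(H i) := by
    intro i hi
    have h1 : #(Q i) ≤ 3 * #((H i).image fun ω => (ω.1.1, ω.2.1)) := by
      refine Finset.card_le_mul_card_image_of_maps_to
        (f := fun p : ℕ × ℕ => (p.2 / k, p.1 % k)) ?_ 3 ?_
      · intro p hp
        have hp2 := hA (hQ i hi p hp).2.1
        rw [Finset.mem_Icc] at hp2
        refine Finset.mem_image.2 ⟨(⟨p.2 / k, Nat.lt_succ_of_le (Nat.div_le_div_right hp2.2)⟩,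
          ⟨p.1 % k, Nat.mod_lt _ hk0⟩), ?_, rfl⟩
        exact Finset.mem_filter.2 ⟨Finset.mem_univ _, p, hp, rfl, rfl⟩
      · rintro ⟨a, b⟩ _
        exact card_fiber_le_three (v i) k a b (Q i) fun p hp => (hQ i hi p hp).2.2
    exact h1.trans (Nat.mul_le_mul_left 3 Finset.card_image_le)
  have hmiss : ∀ i ∈ I, (#(H i)ᶜ : ℝ) ≤ q * Fintype.card (Fin (n / k + 1) × Fin k) := by
    intro i hi
    have e : (#(H i) : ℝ) + #(H i)ᶜ = Fintype.card (Fin (n / k + 1) × Fin k) := by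
      exact_mod_cast Finset.card_add_card_compl (H i)
    have h1 : (#(Q i) : ℝ) ≤ 3 * #(H i) := by exact_mod_cast hH i hi
    have h2 := hQc i hi
    have h3 : (Fintype.card (Fin (n / k + 1) × Fin k) : ℝ) ≤ 2 * n := by
      rw [hΩ]; exact_mod_cast hΩ2
    rw [hq]
    nlinarith
  have hKsmall : #I * q ^ K < 1 := by
    have h1 := hK₀ K (by omega)
    have h2 : (#I : ℝ) ≤ 4 * C * J ^ 2 * (K : ℝ) ^ 2 := by
      have a1 : k + 1 ≤ J * (2 * K) := hkK.trans (Nat.mul_le_mul_left J (by omega))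
      have a2 : n ≤ (J * (2 * K)) * (J * (2 * K)) := hnk.le.trans (Nat.mul_le_mul a1 a1)
      have a3 : #I ≤ 4 * C * J ^ 2 * K ^ 2 := by
        calc #I ≤ C * n := hI
          _ ≤ C * ((J * (2 * K)) * (J * (2 * K))) := Nat.mul_le_mul_left _ a2
          _ = _ := by ring
      exact_mod_cast a3
    calc #I * q ^ K ≤ 4 * C * J ^ 2 * (K : ℝ) ^ 2 * q ^ K := by gcongr
      _ < 1 := by rw [mul_assoc]; exact h1
  obtain ⟨ω, hω⟩ := exists_tuple_hitting I H q K (by rw [hΩ]; positivity) hmiss hKsmall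
  refine ⟨Finset.univ.biUnion fun j => blockResidue A k (ω j).1.1 (ω j).2.1, ?_, ?_, ?_⟩
  · exact Finset.biUnion_subset.2 fun j _ => Finset.filter_subset _ _
  · have h1 : #(Finset.univ.biUnion fun j => blockResidue A k (ω j).1.1 (ω j).2.1)
        ≤ K * (5 * k) := by
      refine Finset.card_biUnion_le.trans ?_
      refine (Finset.sum_le_card_nsmul _ _ (5 * k) fun j _ => ?_).trans ?_
      · exact (card_blockResidue_le hA hk0).trans (by omega)
      · simp
    have h2 : (K : ℝ) ≤ k / J := Nat.cast_div_le
    have hJ' : (5 : ℝ) ≤ η * J := by rw [div_le_iff₀ hη] at hJ; linarith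
    have hJr : (0 : ℝ) < J := by exact_mod_cast hJ0
    have h3 : (K : ℝ) * J ≤ k := by rwa [le_div_iff₀ hJr] at h2
    have h4 : (k : ℝ) * k ≤ n := by exact_mod_cast hkn
    have h5 : (K : ℝ) * 5 ≤ η * k := by
      calc (K : ℝ) * 5 ≤ K * (η * J) := by gcongr
        _ = η * (K * J) := by ring
        _ ≤ η * k := by gcongr
    calc _ ≤ ((K * (5 * k) : ℕ) : ℝ) := by exact_mod_cast h1
      _ = (K * 5) * k := by push_cast; ring
      _ ≤ η * k * k := by gcongr
      _ = η * (k * k) := by ring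
      _ ≤ η * n := by gcongr
  · intro i hi
    obtain ⟨j, hj⟩ := hω i hi
    obtain ⟨p, hp, e1, e2⟩ := (Finset.mem_filter.1 hj).2
    refine ⟨p, hp, ?_, ?_⟩
    · exact Finset.mem_biUnion.2 ⟨j, Finset.mem_univ _,
        Finset.mem_filter.2 ⟨(hQ i hi p hp).1, Or.inr e2⟩⟩
    · exact Finset.mem_biUnion.2 ⟨j, Finset.mem_univ _,
        Finset.mem_filter.2 ⟨(hQ i hi p hp).2.1, Or.inl e1⟩⟩

end Hitting

section Types

instance (x y z : ℕ) : Decidable (SchurRel x y z) :=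
  inferInstanceAs (Decidable (x + y = z ∨ x + z = y ∨ y + z = x))

/-- The pairs in `A` forming a Schur triple with `v` whose set of colors is `e`
and which are not monochromatic. -/
def pairsOfType {r : ℕ} (A : Finset ℕ) (f : ℕ → Fin r) (v : ℕ) (e : Finset (Fin r)) :
    Finset (ℕ × ℕ) :=
  (A ×ˢ A).filter fun p => SchurRel v p.1 p.2 ∧ f p.1 ≠ f p.2 ∧ {f p.1, f p.2} = e

/-- The color pairs which occur at least `s` times in the link of `v`. -/
noncomputable def popularTypes {r : ℕ} (A : Finset ℕ) (f : ℕ → Fin r) (s : ℝ) (v : ℕ) :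
    Finset (Finset (Fin r)) :=
  (Finset.powersetCard 2 Finset.univ).filter fun e => s ≤ (#(pairsOfType A f v e) : ℝ)

/-- The colors which `v` may receive without creating a rainbow sum with two elements of `T`. -/
def allowedColors {r : ℕ} (T : Finset ℕ) (f : ℕ → Fin r) (v : ℕ) : Finset (Fin r) :=
  Finset.univ.filter fun c =>
    ∀ y ∈ T, ∀ w ∈ T, SchurRel v y w → f y ≠ f w → c = f y ∨ c = f w

variable {r : ℕ} {A T : Finset ℕ} {f : ℕ → Fin r} {s : ℝ}

lemma mem_pairsOfType {v : ℕ} {e : Finset (Fin r)} {p : ℕ × ℕ} :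
    p ∈ pairsOfType A f v e ↔ (p.1 ∈ A ∧ p.2 ∈ A) ∧
      SchurRel v p.1 p.2 ∧ f p.1 ≠ f p.2 ∧ {f p.1, f p.2} = e := by
  simp only [pairsOfType, Finset.mem_filter, Finset.mem_product]

/-- Every popular color pair at every `v` is realized by two elements of `T`. -/
def Hits (A T : Finset ℕ) (f : ℕ → Fin r) (s : ℝ) : Prop :=
  ∀ v ∈ A, ∀ e ∈ popularTypes A f s v, ∃ p ∈ pairsOfType A f v e, p.1 ∈ T ∧ p.2 ∈ T

lemma Hits.allowedColors_subset (h : Hits A T f s) {v : ℕ} (hv : v ∈ A) {e : Finset (Fin r)}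
    (he : e ∈ popularTypes A f s v) : allowedColors T f v ⊆ e := by
  obtain ⟨p, hp, h1, h2⟩ := h v hv e he
  obtain ⟨-, h3, h4, rfl⟩ := mem_pairsOfType.1 hp
  intro c hc
  have := (Finset.mem_filter.1 hc).2 p.1 h1 p.2 h2 h3 h4
  simpa using this

lemma mem_popularTypes {v : ℕ} {e : Finset (Fin r)} :
    e ∈ popularTypes A f s v ↔ #e = 2 ∧ s ≤ (#(pairsOfType A f v e) : ℝ) := by
  simp [popularTypes, Finset.mem_powersetCard]

lemma card_of_mem_popularTypes {v : ℕ} {e : Finset (Fin r)} (he : e ∈ popularTypes A f s v) :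
    #e = 2 :=
  (mem_popularTypes.1 he).1

lemma Hits.prod_card_allowedColors_le (h : Hits A T f s) :
    ∏ v ∈ A, #(allowedColors T f v) ≤
      r ^ #(A.filter fun v => popularTypes A f s v = ∅) *
        2 ^ #(A.filter fun v => ¬ 2 ≤ #(popularTypes A f s v)) := by
  rw [← Finset.prod_const, ← Finset.prod_const, Finset.prod_filter, Finset.prod_filter,
    ← Finset.prod_mul_distrib]
  refine Finset.prod_le_prod' fun v hv => ?_
  have hr : #(allowedColors T f v) ≤ r := by
    simpa using Finset.card_le_univ (allowedColors T f v)
  by_cases h0 : popularTypes A f s v = ∅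
  · simp only [h0, if_true, Finset.card_empty]
    simp only [show ¬ (2 ≤ 0) by norm_num, not_false_eq_true, if_true]
    omega
  · obtain ⟨e, he⟩ := Finset.nonempty_iff_ne_empty.2 h0
    have h2 := Finset.card_le_card (h.allowedColors_subset hv he)
    rw [card_of_mem_popularTypes he] at h2
    by_cases h1 : 2 ≤ #(popularTypes A f s v)
    · simp only [h0, if_false, h1, not_true, mul_one]
      obtain ⟨a, ha, b, hb, hab⟩ := Finset.one_lt_card.1 h1
      have hsub : allowedColors T f v ⊆ a ∩ b :=
        Finset.subset_inter (h.allowedColors_subset hv ha) (h.allowedColors_subset hv hb)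
      have hlt : #(a ∩ b) < 2 := by
        by_contra hcon
        have ca := card_of_mem_popularTypes ha
        have cb := card_of_mem_popularTypes hb
        have e1 := Finset.eq_of_subset_of_card_le (Finset.inter_subset_left : a ∩ b ⊆ a)
          (by omega)
        have e2 := Finset.eq_of_subset_of_card_le (Finset.inter_subset_right : a ∩ b ⊆ b)
          (by omega)
        exact hab (e1.symm.trans e2)
      have := Finset.card_le_card hsub
      omega
    · simp only [h0, if_false, h1, not_false_eq_true, if_true, one_mul]
      exact h2

open Classical in
lemma card_le_of_hits {n : ℕ} (hA : A ⊆ Finset.Icc 1 n) (c₀ : Fin r) (F : Finset (ℕ → Fin r))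
    (hsupp : ∀ f ∈ F, ∀ y ∉ A, f y = c₀) (hF : ∀ f ∈ F, RainbowSumFree A f)
    (hT : T ⊆ A) (hits : ∀ f ∈ F, Hits A T f s) (b t : ℝ)
    (hb : ∀ f ∈ F, (#(A.filter fun v => popularTypes A f s v = ∅) : ℝ) ≤ b)
    (ht : ∀ f ∈ F, t ≤ #(A.filter fun v => 2 ≤ #(popularTypes A f s v))) :
    (#F : ℝ) ≤ (r : ℝ) ^ #T * ((2 : ℝ) ^ (r * b + n - t)) := by
  set M : ℝ := (2 : ℝ) ^ (r * b + n - t) with hM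
  have hM0 : 0 ≤ M := by positivity
  let ρ : (ℕ → Fin r) → (T → Fin r) := fun f y => f y
  have h1 : #F ≤ ⌊M⌋₊ * #(F.image ρ) := by
    refine Finset.card_le_mul_card_image F ⌊M⌋₊ fun g hg => ?_
    obtain ⟨f, hf, rfl⟩ := Finset.mem_image.1 hg
    refine Nat.le_floor ?_
    have hagree : ∀ g ∈ F.filter (fun g => ρ g = ρ f), ∀ y ∈ T, g y = f y := fun g hg y hy =>
      congrFun (Finset.mem_filter.1 hg).2 (⟨y, hy⟩ : T)
    have hc : #(F.filter fun g => ρ g = ρ f) ≤ ∏ v ∈ A, #(allowedColors T f v) := by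
      refine card_le_prod_card _ A _ ?_ ?_
      · intro g hg v hv
        refine Finset.mem_filter.2 ⟨Finset.mem_univ _, fun y hy w hw hS hne => ?_⟩
        have hgF := (Finset.mem_filter.1 hg).1
        have := hF g hgF v hv y (hT hy) w (hT hw) hS
        rw [hagree g hg y hy, hagree g hg w hw] at this
        tauto
      · intro g hg g' hg' h
        funext y
        by_cases hy : y ∈ A
        · exact h y hy
        · rw [hsupp g (Finset.mem_filter.1 hg).1 y hy, hsupp g' (Finset.mem_filter.1 hg').1 y hy]
    have hc2 := hc.trans (hits f hf).prod_card_allowedColors_le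
    have hr2 : r ^ #(A.filter fun v => popularTypes A f s v = ∅) ≤
        2 ^ (r * #(A.filter fun v => popularTypes A f s v = ∅)) := by
      rw [pow_mul]; exact Nat.pow_le_pow_left Nat.lt_two_pow_self.le _
    have hc3 := hc2.trans (Nat.mul_le_mul_right _ hr2)
    rw [← pow_add] at hc3
    have hc4 : (#(F.filter fun g => ρ g = ρ f) : ℝ) ≤
        (2 : ℝ) ^ (r * #(A.filter fun v => popularTypes A f s v = ∅) +
        #(A.filter fun v => ¬ 2 ≤ #(popularTypes A f s v))) := by exact_mod_cast hc3
    refine hc4.trans ?_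
    rw [← Real.rpow_natCast]
    refine Real.rpow_le_rpow_of_exponent_le (by norm_num) ?_
    have hsplit := Finset.card_filter_add_card_filter_not (s := A)
      (fun v => 2 ≤ #(popularTypes A f s v))
    have hAn : #A ≤ n := by simpa using Finset.card_le_card hA
    have hsplit' : (#(A.filter fun v => 2 ≤ #(popularTypes A f s v)) : ℝ) +
      #(A.filter fun v => ¬ 2 ≤ #(popularTypes A f s v)) ≤ n := by
      exact_mod_cast hsplit.le.trans hAn
    have := ht f hf
    have hb' := mul_le_mul_of_nonneg_left (hb f hf) (Nat.cast_nonneg r : (0 : ℝ) ≤ r)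
    push_cast
    linarith
  have h2 : #(F.image ρ) ≤ r ^ #T := by
    refine (Finset.card_le_univ _).trans ?_
    simp
  calc (#F : ℝ) ≤ ((⌊M⌋₊ * #(F.image ρ) : ℕ) : ℝ) := by exact_mod_cast h1
    _ = (⌊M⌋₊ : ℝ) * #(F.image ρ) := by push_cast; ring
    _ ≤ M * (r : ℝ) ^ #T := by
        gcongr
        · exact Nat.floor_le hM0
        · exact_mod_cast h2
    _ = _ := mul_comm _ _

lemma card_le_of_many_popularTypes (hr : 1 ≤ r) (ε δ : ℝ) (hε : 0 < ε)
    (hδ : 0 < δ) (hδ1 : δ ≤ 1) :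
    ∃ n₀ : ℕ, ∀ n : ℕ, n₀ ≤ n → ∀ A ⊆ Finset.Icc 1 n, ∀ (c₀ : Fin r) (F : Finset (ℕ → Fin r)),
      (∀ f ∈ F, ∀ y ∉ A, f y = c₀) → (∀ f ∈ F, RainbowSumFree A f) →
      (∀ f ∈ F, (#(A.filter fun v => popularTypes A f (δ * n) v = ∅) : ℝ) ≤ ε / (4 * r) * n) →
      (∀ f ∈ F, ε * n ≤ #(A.filter fun v => 2 ≤ #(popularTypes A f (δ * n) v))) →
      (#F : ℝ) ≤ (2 : ℝ) ^ ((1 - ε / 2) * n) := by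
  classical
  obtain ⟨η, hη, -, hball⟩ := exists_sum_small_subsets_le r (ε / 4) (by exact_mod_cast hr)
    (by linarith)
  obtain ⟨n₀, hn₀⟩ := exists_small_hitting_set δ η hδ hδ1 hη (2 ^ r)
  refine ⟨n₀, fun n hn A hA c₀ F hsupp hF hb ht => ?_⟩
  have hAn : #A ≤ n := by simpa using Finset.card_le_card hA
  have hex : ∀ f ∈ F, ∃ T ∈ A.powerset.filter (fun E => (#E : ℝ) ≤ η * n),
      Hits A T f (δ * n) := by
    intro f hf
    obtain ⟨T, hTA, hTc, hT⟩ := hn₀ n hn A hA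
      ((A ×ˢ (Finset.univ : Finset (Finset (Fin r)))).filter
        fun i => i.2 ∈ popularTypes A f (δ * n) i.1)
      (by
        refine (Finset.card_filter_le _ _).trans ?_
        rw [Finset.card_product, mul_comm]
        simp only [Finset.card_univ, Fintype.card_finset, Fintype.card_fin]
        exact Nat.mul_le_mul_left _ hAn)
      (fun i => i.1) (fun i => pairsOfType A f i.1 i.2)
      (fun i _ p hp => by
        have := mem_pairsOfType.1 hp
        exact ⟨this.1.1, this.1.2, this.2.1⟩)
      (fun i hi => by
        have h := (Finset.mem_filter.1 hi).2
        exact (mem_popularTypes.1 h).2)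
    refine ⟨T, Finset.mem_filter.2 ⟨Finset.mem_powerset.2 hTA, hTc⟩, fun v hv e he => ?_⟩
    exact hT (v, e) (Finset.mem_filter.2 ⟨Finset.mem_product.2 ⟨hv, Finset.mem_univ _⟩, he⟩)
  have h1 := card_le_sum_card_filter F _ (fun T f => Hits A T f (δ * n)) hex
  have hr0 : (0 : ℝ) < r := by exact_mod_cast hr
  calc (#F : ℝ) ≤ ∑ T ∈ A.powerset with (#T : ℝ) ≤ η * n,
        (r : ℝ) ^ #T * (2 : ℝ) ^ (r * (ε / (4 * r) * n) + n - ε * n) := by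
        refine (Nat.cast_le.2 h1).trans ?_
        push_cast
        refine Finset.sum_le_sum fun T hT => ?_
        have hTA := Finset.mem_powerset.1 (Finset.mem_filter.1 hT).1
        refine card_le_of_hits hA c₀ _ ?_ ?_ hTA (fun f hf => (Finset.mem_filter.1 hf).2) _ _ ?_ ?_
        all_goals intro f hf; have hf' := (Finset.mem_filter.1 hf).1
        · exact hsupp f hf'
        · exact hF f hf'
        · exact hb f hf'
        · exact ht f hf'
    _ = (∑ T ∈ A.powerset with (#T : ℝ) ≤ η * n, (r : ℝ) ^ #T) *
          (2 : ℝ) ^ (r * (ε / (4 * r) * n) + n - ε * n) := by rw [Finset.sum_mul]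
    _ ≤ (2 : ℝ) ^ (ε / 4 * n) * (2 : ℝ) ^ (r * (ε / (4 * r) * n) + n - ε * n) := by
        gcongr
        exact hball n A hAn
    _ = _ := by
        rw [← Real.rpow_add (by norm_num)]
        congr 1
        field_simp
        ring

end Types

section Fibers

variable {r n : ℕ} {A E : Finset ℕ}

lemma card_filter_dist_mem_le (A E : Finset ℕ) (x : ℕ) :
    #(A.filter fun y => (y - x) + (x - y) ∈ E) ≤ 2 * #E := by
  have hsub : (A.filter fun y => (y - x) + (x - y) ∈ E) ⊆
      E.image (fun w => x + w) ∪ E.image (fun w => x - w) := by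
    intro y hy
    have hy := (Finset.mem_filter.1 hy).2
    rw [Finset.mem_union, Finset.mem_image, Finset.mem_image]
    rcases le_total x y with h | h
    · exact Or.inl ⟨_, hy, by omega⟩
    · exact Or.inr ⟨_, hy, by omega⟩
  have h1 := (Finset.card_le_card hsub).trans (Finset.card_union_le _ _)
  have h2 : #(E.image fun w => x + w) ≤ #E := Finset.card_image_le
  have h3 : #(E.image fun w => x - w) ≤ #E := Finset.card_image_le
  omega

lemma card_Icc_sdiff (hA : A ⊆ Finset.Icc 1 n) : #(Finset.Icc 1 n \ A) = n - #A := by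
  rw [Finset.card_sdiff_of_subset hA]; simp

lemma card_filter_dist_notMem_le (hA : A ⊆ Finset.Icc 1 n) {x : ℕ} (hx : x ∈ A) :
    #(A.filter fun y => (y - x) + (x - y) ∉ A) ≤ 1 + 2 * (n - #A) := by
  have hsub : (A.filter fun y => (y - x) + (x - y) ∉ A) ⊆
      {x} ∪ A.filter fun y => (y - x) + (x - y) ∈ Finset.Icc 1 n \ A := by
    intro y hy
    obtain ⟨hyA, hy⟩ := Finset.mem_filter.1 hy
    have h1 := Finset.mem_Icc.1 (hA hyA)
    have h2 := Finset.mem_Icc.1 (hA hx)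
    by_cases hxy : y = x
    · simp [hxy]
    · refine Finset.mem_union_right _ (Finset.mem_filter.2 ⟨hyA, Finset.mem_sdiff.2 ⟨?_, hy⟩⟩)
      rw [Finset.mem_Icc]; omega
  have h1 := (Finset.card_le_card hsub).trans (Finset.card_union_le _ _)
  have h2 := card_filter_dist_mem_le A (Finset.Icc 1 n \ A) x
  rw [card_Icc_sdiff hA] at h2
  rw [Finset.card_singleton] at h1
  omega

lemma card_le_of_nearly_two_colored (hr : 1 ≤ r) (hA : A ⊆ Finset.Icc 1 n) (c₀ : Fin r)
    (F : Finset (ℕ → Fin r)) (hsupp : ∀ f ∈ F, ∀ y ∉ A, f y = c₀)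
    (hF : ∀ f ∈ F, RainbowSumFree A f) {τ : Finset (Fin r)} (hτ : #τ = 2) {x : ℕ} (hx : x ∈ A)
    (hxF : ∀ f ∈ F, f x ∉ τ) (hEF : ∀ f ∈ F, ∀ y ∈ A, f y ∉ τ ↔ y ∈ E) :
    #F ≤ (4 * r) ^ #E * 2 ^ (n / 2 + (1 + 2 * (n - #A))) := by
  set R₀ := A.filter fun y => 2 * y ≤ x with hR₀
  set R₁ := A.filter fun y => (y - x) + (x - y) ∉ A with hR₁
  set R₂ := A.filter fun y => (y - x) + (x - y) ∈ E with hR₂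
  set R₃ := A.filter fun y => y ∈ E with hR₃
  set R := R₃ ∪ (R₂ ∪ (R₀ ∪ R₁)) with hR
  let L : ℕ → Finset (Fin r) := fun v => if v ∈ E then Finset.univ else τ
  have hRA : R ⊆ A := by
    refine Finset.union_subset (Finset.filter_subset _ _) (Finset.union_subset
      (Finset.filter_subset _ _) (Finset.union_subset (Finset.filter_subset _ _)
      (Finset.filter_subset _ _)))
  have h1 : #F ≤ ∏ v ∈ R, #(L v) := by
    refine card_le_prod_card F R L ?_ ?_
    · intro f hf v hv
      by_cases hvE : v ∈ E
      · simp [L, hvE]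
      · simp only [L, hvE, if_false]
        by_contra hc
        exact hvE ((hEF f hf v (hRA hv)).1 hc)
    · intro f hf g hg hfg
      funext y
      induction y using Nat.strong_induction_on with
      | _ y ih =>
        by_cases hy : y ∈ A
        swap
        · rw [hsupp f hf y hy, hsupp g hg y hy]
        by_cases hyR : y ∈ R
        · exact hfg y hyR
        simp only [hR, hR₀, hR₁, hR₂, hR₃, Finset.mem_union, Finset.mem_filter, hy, true_and,
          not_or, not_not] at hyR
        obtain ⟨hyE, hwE, h2y, hw⟩ := hyR
        set w := (y - x) + (x - y) with hwdef
        have hS : SchurRel x y w := by unfold SchurRel; omega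
        have hx1 := Finset.mem_Icc.1 (hA hx)
        have hwy : w < y := by omega
        have key : ∀ f ∈ F, f y = f w := by
          intro f hf
          have a1 : f y ∈ τ := by by_contra hc; exact hyE ((hEF f hf y hy).1 hc)
          have a2 : f w ∈ τ := by by_contra hc; exact hwE ((hEF f hf w hw).1 hc)
          have a3 := hxF f hf
          rcases hF f hf x hx y hy w hw hS with h | h | h
          · exact absurd (h ▸ a1) a3
          · exact absurd (h ▸ a2) a3
          · exact h
        rw [key f hf, key g hg, ih w hwy]
  have h2 : ∏ v ∈ R, #(L v) ≤ r ^ #E * 2 ^ #(R.filter fun v => v ∉ E) := by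
    have : ∀ v, #(L v) = if v ∈ E then r else 2 := by
      intro v
      by_cases hv : v ∈ E <;> simp [L, hv, hτ]
    simp only [this]
    rw [Finset.prod_ite, Finset.prod_const, Finset.prod_const]
    refine Nat.mul_le_mul_right _ (Nat.pow_le_pow_right hr ?_)
    exact Finset.card_le_card fun v hv => (Finset.mem_filter.1 hv).2
  have h3 : #(R.filter fun v => v ∉ E) ≤ 2 * #E + (n / 2 + (1 + 2 * (n - #A))) := by
    have hsub : (R.filter fun v => v ∉ E) ⊆ R₂ ∪ (R₀ ∪ R₁) := by
      intro v hv
      obtain ⟨hv, hvE⟩ := Finset.mem_filter.1 hv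
      rcases Finset.mem_union.1 hv with h | h
      · exact absurd (Finset.mem_filter.1 h).2 hvE
      · exact h
    have b1 := (Finset.card_le_card hsub).trans (Finset.card_union_le _ _)
    have b2 := Finset.card_union_le R₀ R₁
    have b3 : #R₂ ≤ 2 * #E := card_filter_dist_mem_le A E x
    have b4 : #R₁ ≤ 1 + 2 * (n - #A) := card_filter_dist_notMem_le hA hx
    have b5 : #R₀ ≤ n / 2 := by
      calc #R₀ ≤ #(Finset.Icc 1 (n / 2)) := by
            refine Finset.card_le_card fun y hy => ?_
            obtain ⟨hyA, hy⟩ := Finset.mem_filter.1 hy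
            have h1 := Finset.mem_Icc.1 (hA hyA)
            have h2 := Finset.mem_Icc.1 (hA hx)
            rw [Finset.mem_Icc]; omega
        _ = n / 2 := by simp
    omega
  calc #F ≤ r ^ #E * 2 ^ #(R.filter fun v => v ∉ E) := h1.trans h2
    _ ≤ r ^ #E * 2 ^ (2 * #E + (n / 2 + (1 + 2 * (n - #A)))) :=
        Nat.mul_le_mul_left _ (Nat.pow_le_pow_right (by norm_num) h3)
    _ = _ := by rw [pow_add, pow_mul, mul_pow]; ring

/-- The class of `c` after identifying all colors in `τ`. -/
def mergeColor (τ : Finset (Fin r)) (c : Fin r) : Finset (Fin r) := if c ∈ τ then τ else {c}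

lemma mergeColor_eq_iff {τ : Finset (Fin r)} {c c' : Fin r} :
    mergeColor τ c = mergeColor τ c' ↔ c = c' ∨ (c ∈ τ ∧ c' ∈ τ) := by
  unfold mergeColor
  split_ifs with h h'
  · simp [h, h']
  · constructor
    · rintro rfl
      exact absurd (Finset.mem_singleton_self _) h'
    · rintro (rfl | ⟨-, h2⟩)
      · exact absurd h h'
      · exact absurd h2 h'
  · rename_i h'
    constructor
    · intro e
      rw [← e] at h'
      exact Or.inl (Finset.mem_singleton.1 (e ▸ h')).symm
    · rintro (rfl | ⟨h2, -⟩)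
      · exact absurd h' h
      · exact absurd h2 h
  · simp [h]

lemma eq_of_mergeColor_eq {τ₁ τ₂ : Finset (Fin r)} (h₁ : #τ₁ = 2) (h₂ : #τ₂ = 2) (hne : τ₁ ≠ τ₂)
    {c c' : Fin r} (e₁ : mergeColor τ₁ c = mergeColor τ₁ c')
    (e₂ : mergeColor τ₂ c = mergeColor τ₂ c') : c = c' := by
  rw [mergeColor_eq_iff] at e₁ e₂
  rcases e₁ with h | ⟨a, a'⟩
  · exact h
  rcases e₂ with h | ⟨b, b'⟩
  · exact h
  by_contra hcc
  have hpair : #({c, c'} : Finset (Fin r)) = 2 := Finset.card_pair hcc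
  have s₁ : ({c, c'} : Finset (Fin r)) ⊆ τ₁ := by
    intro z hz; rcases Finset.mem_insert.1 hz with rfl | hz
    · exact a
    · rwa [Finset.mem_singleton.1 hz]
  have s₂ : ({c, c'} : Finset (Fin r)) ⊆ τ₂ := by
    intro z hz; rcases Finset.mem_insert.1 hz with rfl | hz
    · exact b
    · rwa [Finset.mem_singleton.1 hz]
  exact hne ((Finset.eq_of_subset_of_card_le s₁ (by omega)).symm.trans
    (Finset.eq_of_subset_of_card_le s₂ (by omega)))

/-- Away from `E`, the merged coloring is invariant under the shift by `d`, whenever the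
intermediate point of the step, at distance `|y - x|`, belongs to `A`. -/
def ShiftInvariant (A E : Finset ℕ) (f : ℕ → Fin r) (τ : Finset (Fin r)) (d x : ℕ) : Prop :=
  ∀ y ∈ A, y ∉ E → d < y → y - d ∈ A → (y - x) + (x - y) ∈ A →
    mergeColor τ (f y) = mergeColor τ (f (y - d))

/-- The elements of `A` whose step of length `d` through distance to `x` leaves `A`. -/
def brokenSteps (A : Finset ℕ) (d x : ℕ) : Finset ℕ :=
  A.filter fun y => y ≤ d ∨ y - d ∉ A ∨ (y - x) + (x - y) ∉ A

lemma card_brokenSteps_le (hA : A ⊆ Finset.Icc 1 n) {d x : ℕ} (hx : x ∈ A) :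
    #(brokenSteps A d x) ≤ d + 1 + 3 * (n - #A) := by
  have hsub : brokenSteps A d x ⊆ Finset.Icc 1 d ∪ ((Finset.Icc 1 n \ A).image (fun w => w + d) ∪
      A.filter fun y => (y - x) + (x - y) ∉ A) := by
    intro y hy
    obtain ⟨hyA, hy⟩ := Finset.mem_filter.1 hy
    have h1 := Finset.mem_Icc.1 (hA hyA)
    simp only [Finset.mem_union, Finset.mem_filter, Finset.mem_Icc, Finset.mem_image,
      Finset.mem_sdiff]
    by_cases hd : y ≤ d
    · left; omega
    · rcases hy with h | h | h
      · omega
      · exact Or.inr (Or.inl ⟨y - d, ⟨⟨by omega, by omega⟩, h⟩, by omega⟩)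
      · exact Or.inr (Or.inr ⟨hyA, h⟩)
  have b1 := (Finset.card_le_card hsub).trans (Finset.card_union_le _ _)
  have b2 := Finset.card_union_le ((Finset.Icc 1 n \ A).image (fun w => w + d))
    (A.filter fun y => (y - x) + (x - y) ∉ A)
  have b3 := card_filter_dist_notMem_le hA hx
  have b4 : #((Finset.Icc 1 n \ A).image (fun w => w + d)) ≤ n - #A :=
    Finset.card_image_le.trans (card_Icc_sdiff hA).le
  rw [Nat.card_Icc] at b1
  omega

lemma card_le_of_shiftInvariant (hr : 1 ≤ r) (hA : A ⊆ Finset.Icc 1 n) (c₀ : Fin r)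
    (F : Finset (ℕ → Fin r)) (hsupp : ∀ f ∈ F, ∀ y ∉ A, f y = c₀)
    {τ₁ τ₂ : Finset (Fin r)} (h₁ : #τ₁ = 2) (h₂ : #τ₂ = 2) (hne : τ₁ ≠ τ₂)
    {d₁ d₂ x₁ x₂ D : ℕ} (hx₁ : x₁ ∈ A) (hx₂ : x₂ ∈ A) (hd₁ : 1 ≤ d₁) (hd₂ : 1 ≤ d₂)
    (hd₁' : d₁ ≤ D) (hd₂' : d₂ ≤ D)
    (hF₁ : ∀ f ∈ F, ShiftInvariant A E f τ₁ d₁ x₁)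
    (hF₂ : ∀ f ∈ F, ShiftInvariant A E f τ₂ d₂ x₂) :
    #F ≤ r ^ (#E + 2 * (D + 1 + 3 * (n - #A))) := by
  set R := E ∪ (brokenSteps A d₁ x₁ ∪ brokenSteps A d₂ x₂) with hR
  have h1 : #F ≤ ∏ v ∈ R, #(Finset.univ : Finset (Fin r)) := by
    refine card_le_prod_card F R (fun _ => Finset.univ) (fun _ _ _ _ => Finset.mem_univ _) ?_
    intro f hf g hg hfg
    funext y
    induction y using Nat.strong_induction_on with
    | _ y ih =>
      by_cases hy : y ∈ A
      swap
      · rw [hsupp f hf y hy, hsupp g hg y hy]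
      by_cases hyR : y ∈ R
      · exact hfg y hyR
      simp only [hR, brokenSteps, Finset.mem_union, Finset.mem_filter, hy, true_and,
        not_or, not_not, not_le] at hyR
      obtain ⟨hyE, ⟨a1, a2, a3⟩, ⟨b1, b2, b3⟩⟩ := hyR
      refine eq_of_mergeColor_eq h₁ h₂ hne ?_ ?_
      · rw [hF₁ f hf y hy hyE a1 a2 a3, hF₁ g hg y hy hyE a1 a2 a3, ih (y - d₁) (by omega)]
      · rw [hF₂ f hf y hy hyE b1 b2 b3, hF₂ g hg y hy hyE b1 b2 b3, ih (y - d₂) (by omega)]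
  rw [Finset.prod_const, Finset.card_univ, Fintype.card_fin] at h1
  refine h1.trans (Nat.pow_le_pow_right hr ?_)
  have b1 := Finset.card_union_le E (brokenSteps A d₁ x₁ ∪ brokenSteps A d₂ x₂)
  rw [← hR] at b1
  have b2 := Finset.card_union_le (brokenSteps A d₁ x₁) (brokenSteps A d₂ x₂)
  have b3 := card_brokenSteps_le hA hx₁ (d := d₁)
  have b4 := card_brokenSteps_le hA hx₂ (d := d₂)
  omega

end Fibers

section Structure

variable {r n : ℕ} {A : Finset ℕ} {f : ℕ → Fin r} {s : ℝ} {τ : Finset (Fin r)}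

/-- The elements of `A` at which no color pair other than `τ` is popular. -/
noncomputable def nearPeriods (A : Finset ℕ) (f : ℕ → Fin r) (s : ℝ) (τ : Finset (Fin r)) :
    Finset ℕ :=
  A.filter fun v => popularTypes A f s v ⊆ {τ}

/-- The pairs in the link of `v` which are not monochromatic after identifying the colors
in `τ`. -/
def brokenPairs (A : Finset ℕ) (f : ℕ → Fin r) (τ : Finset (Fin r)) (v : ℕ) :
    Finset (ℕ × ℕ) :=
  (A ×ˢ A).filter fun p =>
    SchurRel v p.1 p.2 ∧ mergeColor τ (f p.1) ≠ mergeColor τ (f p.2)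

lemma card_brokenPairs_le (hs : 0 ≤ s) {v : ℕ} (hv : v ∈ nearPeriods A f s τ) :
    (#(brokenPairs A f τ v) : ℝ) ≤ 2 ^ r * s := by
  have hv2 := (Finset.mem_filter.1 hv).2
  have hsub : brokenPairs A f τ v ⊆
      ((Finset.univ : Finset (Finset (Fin r))).filter fun e => #e = 2 ∧ e ≠ τ).biUnion
        fun e => pairsOfType A f v e := by
    intro p hp
    obtain ⟨hpA, hS, hm⟩ := Finset.mem_filter.1 hp
    rw [Ne, mergeColor_eq_iff, not_or] at hm
    refine Finset.mem_biUnion.2 ⟨{f p.1, f p.2}, ?_, ?_⟩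
    · refine Finset.mem_filter.2 ⟨Finset.mem_univ _, Finset.card_pair hm.1, ?_⟩
      rintro rfl
      exact hm.2 (by simp)
    · exact mem_pairsOfType.2 ⟨Finset.mem_product.1 hpA, hS, hm.1, rfl⟩
  have h1 := (Finset.card_le_card hsub).trans Finset.card_biUnion_le
  calc (#(brokenPairs A f τ v) : ℝ)
      ≤ ∑ e ∈ (Finset.univ : Finset (Finset (Fin r))).filter fun e => #e = 2 ∧ e ≠ τ,
          (#(pairsOfType A f v e) : ℝ) := by exact_mod_cast h1
    _ ≤ #((Finset.univ : Finset (Finset (Fin r))).filter fun e => #e = 2 ∧ e ≠ τ) • s := by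
        refine Finset.sum_le_card_nsmul _ _ _ fun e he => ?_
        obtain ⟨-, h2, hne⟩ := Finset.mem_filter.1 he
        by_contra hc
        exact hne (Finset.mem_singleton.1 (hv2 (mem_popularTypes.2 ⟨h2, (not_le.1 hc).le⟩)))
    _ ≤ 2 ^ r * s := by
        rw [nsmul_eq_mul]
        gcongr
        have := Finset.card_filter_le (Finset.univ : Finset (Finset (Fin r)))
          (fun e => #e = 2 ∧ e ≠ τ)
        rw [Finset.card_univ, Fintype.card_finset, Fintype.card_fin] at this
        exact_mod_cast this

lemma exists_shiftInvariant (hs : 0 ≤ s) {v d : ℕ}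
    (hv : v ∈ nearPeriods A f s τ) (hv' : v + d ∈ nearPeriods A f s τ) :
    ∃ E ⊆ A, (#E : ℝ) ≤ 2 * (2 ^ r * s) ∧ ShiftInvariant A E f τ d (v + d) := by
  set x := v + d with hx
  set E := A.filter fun y => d < y ∧ y - d ∈ A ∧ (y - x) + (x - y) ∈ A ∧
    mergeColor τ (f y) ≠ mergeColor τ (f (y - d)) with hE
  refine ⟨E, Finset.filter_subset _ _, ?_, ?_⟩
  · have hsplit := Finset.card_filter_add_card_filter_not (s := E)
      (fun y => mergeColor τ (f (y - d)) ≠ mergeColor τ (f ((y - x) + (x - y))))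
    have c1 : #(E.filter fun y =>
        mergeColor τ (f (y - d)) ≠ mergeColor τ (f ((y - x) + (x - y)))) ≤
        #(brokenPairs A f τ v) := by
      refine Finset.card_le_card_of_injOn (fun y => (y - d, (y - x) + (x - y))) ?_ ?_
      · intro y hy
        obtain ⟨hy, hm⟩ := Finset.mem_filter.1 hy
        obtain ⟨hyA, h1, h2, h3, h4⟩ := Finset.mem_filter.1 hy
        refine Finset.mem_coe.2 (Finset.mem_filter.2 ⟨Finset.mem_product.2 ⟨h2, h3⟩, ?_, hm⟩)
        simp only [SchurRel]
        omega
      · intro y hy y' hy' h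
        have h1 := (Finset.mem_filter.1 (Finset.mem_filter.1 hy).1).2.1
        have h2 := (Finset.mem_filter.1 (Finset.mem_filter.1 hy').1).2.1
        have := congrArg Prod.fst h
        simp only at this
        omega
    have c2 : #(E.filter fun y =>
        ¬ mergeColor τ (f (y - d)) ≠ mergeColor τ (f ((y - x) + (x - y)))) ≤
        #(brokenPairs A f τ x) := by
      refine Finset.card_le_card_of_injOn (fun y => (y, (y - x) + (x - y))) ?_ ?_
      · intro y hy
        obtain ⟨hy, hm⟩ := Finset.mem_filter.1 hy
        obtain ⟨hyA, h1, h2, h3, h4⟩ := Finset.mem_filter.1 hy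
        rw [not_not] at hm
        refine Finset.mem_coe.2 (Finset.mem_filter.2 ⟨Finset.mem_product.2 ⟨hyA, h3⟩, ?_, ?_⟩)
        · simp only [SchurRel]
          omega
        · rw [← hm]; exact h4
      · intro y hy y' hy' h
        exact congrArg Prod.fst h
    have b1 := card_brokenPairs_le hs hv
    have b2 := card_brokenPairs_le hs hv'
    have hle : (#E : ℝ) ≤ #(brokenPairs A f τ v) + #(brokenPairs A f τ x) := by
      exact_mod_cast hsplit.ge.trans (Nat.add_le_add c1 c2)
    linarith
  · intro y hy hyE h1 h2 h3
    by_contra hc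
    exact hyE (Finset.mem_filter.2 ⟨hy, h1, h2, h3, hc⟩)

lemma exists_close_pair {W : Finset ℕ} {D : ℕ} (hW : ∀ v ∈ W, v ≤ n) (hD : 0 < D)
    (hcard : n / D + 1 < #W) : ∃ v d, v ∈ W ∧ v + d ∈ W ∧ 1 ≤ d ∧ d ≤ D := by
  obtain ⟨v, hv, w, hw, hne, heq⟩ := Finset.exists_ne_map_eq_of_card_lt_of_maps_to
    (s := W) (t := Finset.range (n / D + 1)) (f := fun v => v / D) (by simpa using hcard)
    (fun v hv => by
      simp only [Finset.coe_range, Set.mem_Iio]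
      exact Nat.lt_succ_of_le (Nat.div_le_div_right (hW v hv)))
  have e1 := Nat.div_add_mod v D
  have e2 := Nat.div_add_mod w D
  have l1 := Nat.mod_lt v hD
  have l2 := Nat.mod_lt w hD
  rw [heq] at e1
  rcases lt_or_gt_of_ne hne with h | h
  · exact ⟨v, w - v, hv, by rwa [Nat.add_sub_cancel' h.le], by omega, by omega⟩
  · exact ⟨w, v - w, hw, by rwa [Nat.add_sub_cancel' h.le], by omega, by omega⟩

lemma ShiftInvariant.mono {E E' : Finset ℕ} {d x : ℕ} (h : ShiftInvariant A E f τ d x)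
    (hE : E ⊆ E') : ShiftInvariant A E' f τ d x :=
  fun y hy hyE => h y hy fun hc => hyE (hE hc)

lemma mem_of_mem_popularTypes (hs : 0 < s) (hf : RainbowSumFree A f) {v : ℕ} (hv : v ∈ A)
    {e : Finset (Fin r)} (he : e ∈ popularTypes A f s v) : f v ∈ e := by
  have h := (mem_popularTypes.1 he).2
  have hpos : 0 < #(pairsOfType A f v e) := by
    have : (0 : ℝ) < #(pairsOfType A f v e) := hs.trans_le h
    exact_mod_cast this
  obtain ⟨p, hp⟩ := Finset.card_pos.1 hpos
  obtain ⟨⟨h1, h2⟩, hS, hne, rfl⟩ := mem_pairsOfType.1 hp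
  have := hf v hv _ h1 _ h2 hS
  simp only [Finset.mem_insert, Finset.mem_singleton]
  tauto

/-- If every color pair other than `τ` has few near-periods but `τ` misses many elements, then
many elements have two popular color pairs. -/
lemma card_notMem_le (hr : 3 ≤ r) (hs : 0 < s) (hf : RainbowSumFree A f) {b : ℝ} (hb : 0 ≤ b)
    (h : ∀ τ' : Finset (Fin r), #τ' = 2 → τ' ≠ τ → (#(nearPeriods A f s τ') : ℝ) ≤ b) :
    (#(A.filter fun v => f v ∉ τ) : ℝ) ≤
      #(A.filter fun v => 2 ≤ #(popularTypes A f s v)) + 2 ^ r * b := by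
  set I := (Finset.univ : Finset (Finset (Fin r))).filter fun e => #e = 2 ∧ e ≠ τ with hI
  have hIne : ∃ e, e ∈ I := by
    have hcard : 1 < #(Finset.powersetCard 2 (Finset.univ : Finset (Fin r))) := by
      rw [Finset.card_powersetCard, Finset.card_univ, Fintype.card_fin]
      calc 1 < Nat.choose 3 2 := by decide
        _ ≤ r.choose 2 := Nat.choose_le_choose 2 hr
    obtain ⟨e, he, hne⟩ := Finset.exists_mem_ne hcard τ
    exact ⟨e, Finset.mem_filter.2 ⟨Finset.mem_univ _, (Finset.mem_powersetCard.1 he).2, hne⟩⟩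
  have hsub : (A.filter fun v => f v ∉ τ) ⊆
      (A.filter fun v => 2 ≤ #(popularTypes A f s v)) ∪ I.biUnion (nearPeriods A f s) := by
    intro v hv
    obtain ⟨hvA, hvτ⟩ := Finset.mem_filter.1 hv
    by_cases h2 : 2 ≤ #(popularTypes A f s v)
    · exact Finset.mem_union_left _ (Finset.mem_filter.2 ⟨hvA, h2⟩)
    refine Finset.mem_union_right _ (Finset.mem_biUnion.2 ?_)
    rcases Finset.card_le_one_iff_subset_singleton.1 (show #(popularTypes A f s v) ≤ 1 by omega)
      with ⟨e, he⟩
    rcases Finset.subset_singleton_iff.1 he with h0 | h1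
    · obtain ⟨e', he'⟩ := hIne
      exact ⟨e', he', Finset.mem_filter.2 ⟨hvA, by simp [h0]⟩⟩
    · have hmem : e ∈ popularTypes A f s v := by rw [h1]; exact Finset.mem_singleton_self e
      refine ⟨e, Finset.mem_filter.2 ⟨Finset.mem_univ _, card_of_mem_popularTypes hmem, ?_⟩,
        Finset.mem_filter.2 ⟨hvA, he⟩⟩
      rintro rfl
      exact hvτ (mem_of_mem_popularTypes hs hf hvA hmem)
  have h1 := (Finset.card_le_card hsub).trans (Finset.card_union_le _ _)
  have h2 : (#(I.biUnion (nearPeriods A f s)) : ℝ) ≤ 2 ^ r * b := by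
    calc (#(I.biUnion (nearPeriods A f s)) : ℝ) ≤ ∑ e ∈ I, (#(nearPeriods A f s e) : ℝ) := by
          exact_mod_cast Finset.card_biUnion_le
      _ ≤ #I • b := Finset.sum_le_card_nsmul _ _ _ fun e he => by
          obtain ⟨-, h2, hne⟩ := Finset.mem_filter.1 he
          exact h e h2 hne
      _ ≤ 2 ^ r * b := by
          rw [nsmul_eq_mul]
          gcongr
          have := Finset.card_filter_le (Finset.univ : Finset (Finset (Fin r)))
            (fun e => #e = 2 ∧ e ≠ τ)
          rw [Finset.card_univ, Fintype.card_finset, Fintype.card_fin] at this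
          exact_mod_cast this
  calc _ ≤ (#(A.filter fun v => 2 ≤ #(popularTypes A f s v)) : ℝ) +
        #(I.biUnion (nearPeriods A f s)) := by exact_mod_cast h1
    _ ≤ _ := by gcongr

end Structure

section Asymptotics

lemma eventually_mul_sq_le (C c : ℝ) (hc : 0 < c) :
    ∀ᶠ n : ℕ in atTop, C * (n : ℝ) ^ 2 ≤ (2 : ℝ) ^ (c * n) := by
  have h2 : (1 : ℝ) < 2 ^ c := Real.one_lt_rpow (by norm_num) hc
  have hq0 : (0 : ℝ) < ((2 : ℝ) ^ c)⁻¹ := by positivity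
  have hq1 : ((2 : ℝ) ^ c)⁻¹ < 1 := inv_lt_one_of_one_lt₀ h2
  have hlim := (tendsto_pow_const_mul_const_pow_of_abs_lt_one 2
    (by rw [abs_of_pos hq0]; exact hq1 : |((2 : ℝ) ^ c)⁻¹| < 1)).const_mul C
  rw [mul_zero] at hlim
  filter_upwards [hlim.eventually (gt_mem_nhds one_pos)] with n hn
  rw [Real.rpow_mul (by norm_num), Real.rpow_natCast]
  rw [inv_pow, ← mul_assoc, ← div_eq_mul_inv, div_lt_one (by positivity)] at hn
  exact hn.le

lemma eventually_three_mul_le (c : ℝ) (hc : 0 < c) :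
    ∀ᶠ n : ℕ in atTop, 3 * (2 : ℝ) ^ ((1 - c) * n) ≤
      (2 : ℝ) ^ (-(n : ℝ) / (26 * Real.logb 2 n)) * 2 ^ n := by
  have hlog : Tendsto (fun n : ℕ => Real.logb 2 (n : ℝ)) atTop atTop :=
    (Real.tendsto_logb_atTop (by norm_num)).comp tendsto_natCast_atTop_atTop
  filter_upwards [hlog.eventually_ge_atTop (1 / c), eventually_ge_atTop (⌈4 / c⌉₊)] with n h1 h2
  have h2' : 4 / c ≤ n := Nat.ceil_le.1 h2
  have hn : (0 : ℝ) < n := lt_of_lt_of_le (by positivity) h2'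
  have hl : 0 < Real.logb 2 (n : ℝ) := lt_of_lt_of_le (by positivity) h1
  rw [div_le_iff₀ hc] at h1 h2'
  have h3 : (n : ℝ) / (26 * Real.logb 2 n) ≤ c * n / 2 := by
    rw [div_le_div_iff₀ (by positivity) (by norm_num)]
    nlinarith
  rw [← Real.rpow_natCast, ← Real.rpow_add (by norm_num)]
  calc 3 * (2 : ℝ) ^ ((1 - c) * n) ≤ (2 : ℝ) ^ (2 : ℝ) * (2 : ℝ) ^ ((1 - c) * n) := by
        gcongr; norm_num
    _ = (2 : ℝ) ^ (2 + (1 - c) * n) := by rw [← Real.rpow_add (by norm_num)]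
    _ ≤ _ := by
        refine Real.rpow_le_rpow_of_exponent_le (by norm_num) ?_
        rw [neg_div]
        nlinarith

end Asymptotics

section Cases

variable {r : ℕ}

/-- The size condition `|A| ≥ (1 - r⁻³) n` in terms of the number of missing elements. -/
def NearlyFull (r n : ℕ) (A : Finset ℕ) : Prop :=
  A ⊆ Finset.Icc 1 n ∧ r ^ 3 * (n - #A) ≤ n

lemma NearlyFull.mul_le {n : ℕ} {A : Finset ℕ} (hr : 3 ≤ r) (h : NearlyFull r n A) :
    9 * (r * (n - #A)) ≤ n := by
  refine le_trans ?_ h.2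
  rw [← mul_assoc]
  refine Nat.mul_le_mul_right _ ?_
  have : 3 * 3 ≤ r * r := Nat.mul_le_mul hr hr
  calc 9 * r ≤ (r * r) * r := Nat.mul_le_mul_right _ this
    _ = r ^ 3 := by ring

lemma card_nearly_two_colored_le (hr : 3 ≤ r) (ε : ℝ)
    (hball : ∀ n : ℕ, ∀ X : Finset ℕ, #X ≤ n →
      ∑ E ∈ X.powerset with (#E : ℝ) ≤ ε * n, (4 * r : ℝ) ^ #E ≤ (2 : ℝ) ^ (1 / 100 * n : ℝ)) :
    ∀ᶠ n : ℕ in atTop, ∀ A, NearlyFull r n A → ∀ (c₀ : Fin r) (F : Finset (ℕ → Fin r)),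
      (∀ f ∈ F, ∀ y ∉ A, f y = c₀) → (∀ f ∈ F, RainbowSumFree A f) →
      (∀ f ∈ F, ∃ τ : Finset (Fin r), #τ = 2 ∧ (∃ x ∈ A, f x ∉ τ) ∧
        (#(A.filter fun v => f v ∉ τ) : ℝ) ≤ ε * n) →
      (#F : ℝ) ≤ (2 : ℝ) ^ (3 / 4 * n : ℝ) := by
  classical
  filter_upwards [eventually_mul_sq_le (2 ^ r * 2) (1 / 100) (by norm_num),
    eventually_ge_atTop 1] with n hn hn1 A hAf c₀ F hsupp hF hτF
  have hA := hAf.1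
  have hAn : #A ≤ n := by simpa using Finset.card_le_card hA
  set S := A.powerset.filter (fun E => (#E : ℝ) ≤ ε * n) with hS
  let P : (Finset (Fin r) × ℕ) × Finset ℕ → (ℕ → Fin r) → Prop := fun i f =>
    #i.1.1 = 2 ∧ i.1.2 ∈ A ∧ f i.1.2 ∉ i.1.1 ∧ ∀ y ∈ A, f y ∉ i.1.1 ↔ y ∈ i.2
  have h1 := card_le_sum_card_filter F
    (((Finset.univ : Finset (Finset (Fin r))) ×ˢ A) ×ˢ S) P (by
      intro f hf
      obtain ⟨τ, hτ, ⟨x, hx, hxτ⟩, hsmall⟩ := hτF f hf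
      refine ⟨((τ, x), A.filter fun v => f v ∉ τ), ?_, hτ, hx, hxτ, ?_⟩
      · simp only [Finset.mem_product, Finset.mem_univ, true_and, hx, hS, Finset.mem_filter,
          Finset.mem_powerset, Finset.filter_subset]
        exact hsmall
      · intro y hy
        simp [hy])
  set m := n - #A with hm
  have h2 : ∀ i ∈ ((Finset.univ : Finset (Finset (Fin r))) ×ˢ A) ×ˢ S,
      #(F.filter (P i)) ≤ (4 * r) ^ #i.2 * 2 ^ (n / 2 + (1 + 2 * m)) := by
    intro i hi
    rcases (F.filter (P i)).eq_empty_or_nonempty with h0 | ⟨f, hf⟩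
    · rw [h0, Finset.card_empty]; exact Nat.zero_le _
    have hfP := (Finset.mem_filter.1 hf).2
    exact card_le_of_nearly_two_colored (by omega) hA c₀ _
      (fun f hf => hsupp f (Finset.mem_filter.1 hf).1)
      (fun f hf => hF f (Finset.mem_filter.1 hf).1) hfP.1 hfP.2.1
      (fun f hf => (Finset.mem_filter.1 hf).2.2.2.1)
      (fun f hf => (Finset.mem_filter.1 hf).2.2.2.2)
  have h3 : #F ≤ ∑ i ∈ ((Finset.univ : Finset (Finset (Fin r))) ×ˢ A) ×ˢ S,
      (4 * r) ^ #i.2 * 2 ^ (n / 2 + (1 + 2 * m)) := h1.trans (Finset.sum_le_sum h2)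
  rw [Finset.sum_product] at h3
  simp only [Finset.sum_const, Finset.card_product, Finset.card_univ, Fintype.card_finset,
    Fintype.card_fin, smul_eq_mul] at h3
  rw [← Finset.sum_mul] at h3
  have h4 : (#F : ℝ) ≤ 2 ^ r * #A * ((∑ E ∈ S, (4 * r : ℝ) ^ #E) *
      2 ^ (n / 2 + (1 + 2 * m))) := by exact_mod_cast h3
  have hm27 : 27 * m ≤ n := by
    have : 9 * (r * m) ≤ n := hAf.mul_le hr
    have h9 : 9 * (3 * m) ≤ 9 * (r * m) := by gcongr
    omega
  have hm27' : (27 : ℝ) * m ≤ n := by exact_mod_cast hm27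
  have hpow : (2 : ℝ) ^ (n / 2 + (1 + 2 * m)) ≤ 2 * 2 ^ ((1 / 2 + 2 / 27) * n : ℝ) := by
    rw [show n / 2 + (1 + 2 * m) = 1 + (n / 2 + 2 * m) by ring, pow_add, pow_one]
    gcongr
    rw [← Real.rpow_natCast]
    refine Real.rpow_le_rpow_of_exponent_le (by norm_num) ?_
    have : ((n / 2 : ℕ) : ℝ) ≤ n / 2 := Nat.cast_div_le
    push_cast
    linarith
  have hn1' : (1 : ℝ) ≤ n := by exact_mod_cast hn1
  calc (#F : ℝ) ≤ 2 ^ r * #A * ((∑ E ∈ S, (4 * r : ℝ) ^ #E) *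
      2 ^ (n / 2 + (1 + 2 * m))) := h4
    _ ≤ 2 ^ r * (n : ℝ) ^ 2 * ((2 : ℝ) ^ (1 / 100 * n : ℝ) *
      (2 * 2 ^ ((1 / 2 + 2 / 27) * n : ℝ))) := by
        gcongr
        · calc (#A : ℝ) ≤ n := by exact_mod_cast hAn
            _ ≤ (n : ℝ) ^ 2 := by nlinarith
        · exact hball n A hAn
    _ = (2 ^ r * 2 * (n : ℝ) ^ 2) * ((2 : ℝ) ^ (1 / 100 * n : ℝ) *
      2 ^ ((1 / 2 + 2 / 27) * n : ℝ)) := by ring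
    _ ≤ (2 : ℝ) ^ (1 / 100 * n : ℝ) * ((2 : ℝ) ^ (1 / 100 * n : ℝ) *
      2 ^ ((1 / 2 + 2 / 27) * n : ℝ)) := by gcongr
    _ ≤ _ := by
        rw [← Real.rpow_add (by norm_num), ← Real.rpow_add (by norm_num)]
        refine Real.rpow_le_rpow_of_exponent_le (by norm_num) ?_
        linarith

lemma card_nearly_periodic_le (hr : 3 ≤ r) (ε δ b : ℝ) (hδ : 0 < δ)
    (hδε : 4 * (2 ^ r * δ) ≤ ε) (hb : 0 < b)
    (hball : ∀ n : ℕ, ∀ X : Finset ℕ, #X ≤ n →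
      ∑ E ∈ X.powerset with (#E : ℝ) ≤ ε * n, (4 * r : ℝ) ^ #E ≤ (2 : ℝ) ^ (1 / 100 * n : ℝ)) :
    ∀ᶠ n : ℕ in atTop, ∀ A, NearlyFull r n A → ∀ (c₀ : Fin r) (F : Finset (ℕ → Fin r)),
      (∀ f ∈ F, ∀ y ∉ A, f y = c₀) →
      (∀ f ∈ F, ∃ τ₁ τ₂ : Finset (Fin r), #τ₁ = 2 ∧ #τ₂ = 2 ∧ τ₁ ≠ τ₂ ∧
        b * n < #(nearPeriods A f (δ * n) τ₁) ∧ b * n < #(nearPeriods A f (δ * n) τ₂)) →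
      (#F : ℝ) ≤ (2 : ℝ) ^ (3 / 4 * n : ℝ) := by
  classical
  obtain ⟨D, hD⟩ := exists_nat_ge (2 / b)
  have hDr : (0 : ℝ) < D := lt_of_lt_of_le (by positivity) hD
  have hD0 : 0 < D := by exact_mod_cast hDr
  filter_upwards [eventually_mul_sq_le (4 ^ r * (D + 1) ^ 2 * r ^ (2 * (D + 1))) (1 / 100)
    (by norm_num), eventually_ge_atTop (⌈2 / b⌉₊)] with n hn hn2 A hAf c₀ F hsupp hτF
  have hA := hAf.1
  have hAn : #A ≤ n := by simpa using Finset.card_le_card hA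
  have hn2' : 2 / b ≤ n := Nat.ceil_le.1 hn2
  have hs : 0 ≤ δ * n := by positivity
  set S := A.powerset.filter (fun E => (#E : ℝ) ≤ ε * n) with hS
  have hshift : ∀ (f : ℕ → Fin r) (τ : Finset (Fin r)), b * n < #(nearPeriods A f (δ * n) τ) →
      ∃ d x, ∃ E ⊆ A, x ∈ A ∧ 1 ≤ d ∧ d ≤ D ∧ (#E : ℝ) ≤ 2 * (2 ^ r * (δ * n)) ∧
        ShiftInvariant A E f τ d x := by
    intro f τ hτ
    have hWA : nearPeriods A f (δ * n) τ ⊆ A := Finset.filter_subset _ _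
    have hcard : n / D + 1 < #(nearPeriods A f (δ * n) τ) := by
      have h1 : ((n / D : ℕ) : ℝ) ≤ n / D := Nat.cast_div_le
      have h2 : (n : ℝ) / D ≤ b * n / 2 := by
        rw [div_le_div_iff₀ hDr (by norm_num)]
        rw [div_le_iff₀ hb] at hD
        have : (0 : ℝ) ≤ n := Nat.cast_nonneg n
        nlinarith
      have h3 : 1 ≤ b * n / 2 := by
        rw [div_le_iff₀ hb] at hn2'
        linarith
      have : ((n / D + 1 : ℕ) : ℝ) < #(nearPeriods A f (δ * n) τ) := by
        push_cast
        linarith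
      exact_mod_cast this
    obtain ⟨v, d, hv, hv', hd1, hdD⟩ := exists_close_pair
      (fun v hv => (Finset.mem_Icc.1 (hA (hWA hv))).2) hD0 hcard
    obtain ⟨E, hEA, hEc, hE⟩ := exists_shiftInvariant hs hv hv'
    exact ⟨d, v + d, E, hEA, hWA hv', hd1, hdD, hEc, hE⟩
  let Λ := ((Finset.univ : Finset (Finset (Fin r))) ×ˢ (Finset.range (D + 1) ×ˢ A)) ×ˢ
    ((Finset.univ : Finset (Finset (Fin r))) ×ˢ (Finset.range (D + 1) ×ˢ A))
  let P : ((Finset (Fin r) × (ℕ × ℕ)) × (Finset (Fin r) × (ℕ × ℕ))) × Finset ℕ →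
      (ℕ → Fin r) → Prop := fun i f =>
    (#i.1.1.1 = 2 ∧ #i.1.2.1 = 2 ∧ i.1.1.1 ≠ i.1.2.1 ∧ 1 ≤ i.1.1.2.1 ∧ 1 ≤ i.1.2.2.1) ∧
      ShiftInvariant A i.2 f i.1.1.1 i.1.1.2.1 i.1.1.2.2 ∧
      ShiftInvariant A i.2 f i.1.2.1 i.1.2.2.1 i.1.2.2.2
  have h1 := card_le_sum_card_filter F (Λ ×ˢ S) P (by
      intro f hf
      obtain ⟨τ₁, τ₂, c₁, c₂, hne, w₁, w₂⟩ := hτF f hf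
      obtain ⟨d₁, x₁, E₁, hE₁, hx₁, hd₁, hd₁', hc₁, hi₁⟩ := hshift f τ₁ w₁
      obtain ⟨d₂, x₂, E₂, hE₂, hx₂, hd₂, hd₂', hc₂, hi₂⟩ := hshift f τ₂ w₂
      refine ⟨(((τ₁, (d₁, x₁)), (τ₂, (d₂, x₂))), E₁ ∪ E₂), ?_, ⟨c₁, c₂, hne, hd₁, hd₂⟩,
        hi₁.mono Finset.subset_union_left, hi₂.mono Finset.subset_union_right⟩
      simp only [Λ, hS, Finset.mem_product, Finset.mem_univ, true_and, hx₁, hx₂, and_true,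
        Finset.mem_range, Finset.mem_filter, Finset.mem_powerset]
      refine ⟨⟨by omega, by omega⟩, Finset.union_subset hE₁ hE₂, ?_⟩
      have hu : (#(E₁ ∪ E₂) : ℝ) ≤ #E₁ + #E₂ := by exact_mod_cast Finset.card_union_le E₁ E₂
      have := mul_le_mul_of_nonneg_right hδε (Nat.cast_nonneg n : (0 : ℝ) ≤ n)
      linarith)
  set m := n - #A with hm
  have h2 : ∀ i ∈ Λ ×ˢ S, #(F.filter (P i)) ≤ (4 * r) ^ #i.2 * r ^ (2 * (D + 1 + 3 * m)) := by
    rintro ⟨⟨⟨τ₁, d₁, x₁⟩, ⟨τ₂, d₂, x₂⟩⟩, E⟩ hi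
    rcases (F.filter (P (((τ₁, d₁, x₁), (τ₂, d₂, x₂)), E))).eq_empty_or_nonempty with
      h0 | ⟨f, hf⟩
    · rw [h0, Finset.card_empty]; exact Nat.zero_le _
    obtain ⟨⟨c₁, c₂, hne, hd₁, hd₂⟩, -⟩ := (Finset.mem_filter.1 hf).2
    simp only [Λ, Finset.mem_product, Finset.mem_univ, true_and, Finset.mem_range] at hi
    obtain ⟨⟨⟨hd₁', hx₁⟩, ⟨hd₂', hx₂⟩⟩, -⟩ := hi
    refine (card_le_of_shiftInvariant (by omega) hA c₀ _
      (fun f hf => hsupp f (Finset.mem_filter.1 hf).1) c₁ c₂ hne hx₁ hx₂ hd₁ hd₂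
      (Nat.lt_succ_iff.1 hd₁') (Nat.lt_succ_iff.1 hd₂')
      (fun f hf => (Finset.mem_filter.1 hf).2.2.1)
      (fun f hf => (Finset.mem_filter.1 hf).2.2.2)).trans ?_
    rw [pow_add]
    exact Nat.mul_le_mul_right _ (Nat.pow_le_pow_left (by omega) _)
  have h3 : #F ≤ ∑ i ∈ Λ ×ˢ S, (4 * r) ^ #i.2 * r ^ (2 * (D + 1 + 3 * m)) :=
    h1.trans (Finset.sum_le_sum h2)
  rw [Finset.sum_product] at h3
  simp only [Finset.sum_const, smul_eq_mul] at h3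
  rw [← Finset.sum_mul] at h3
  have hΛ : (#Λ : ℝ) ≤ 4 ^ r * (D + 1) ^ 2 * (n : ℝ) ^ 2 := by
    have e : #Λ = 4 ^ r * (D + 1) ^ 2 * #A ^ 2 := by
      simp only [Λ, Finset.card_product, Finset.card_univ, Fintype.card_finset,
        Fintype.card_fin, Finset.card_range]
      rw [show 4 = 2 * 2 by norm_num, mul_pow]
      ring
    rw [e]
    push_cast
    gcongr
  have h4 : (#F : ℝ) ≤ #Λ * ((∑ E ∈ S, (4 * r : ℝ) ^ #E) *
      r ^ (2 * (D + 1 + 3 * m))) := by exact_mod_cast h3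
  have hpow : (r : ℝ) ^ (2 * (D + 1 + 3 * m)) ≤
      r ^ (2 * (D + 1)) * 2 ^ (2 / 3 * n : ℝ) := by
    rw [show 2 * (D + 1 + 3 * m) = 2 * (D + 1) + 6 * m by ring, pow_add]
    gcongr
    have hr2 : (r : ℝ) ≤ 2 ^ r := by exact_mod_cast Nat.lt_two_pow_self.le
    calc (r : ℝ) ^ (6 * m) ≤ ((2 : ℝ) ^ r) ^ (6 * m) := by gcongr
      _ = (2 : ℝ) ^ (((r * (6 * m) : ℕ)) : ℝ) := by rw [Real.rpow_natCast, ← pow_mul]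
      _ ≤ _ := by
          refine Real.rpow_le_rpow_of_exponent_le (by norm_num) ?_
          have : (9 : ℝ) * (r * m) ≤ n := by exact_mod_cast hAf.mul_le hr
          push_cast
          linarith
  have hn0 : (0 : ℝ) ≤ n := Nat.cast_nonneg n
  calc (#F : ℝ) ≤ #Λ * ((∑ E ∈ S, (4 * r : ℝ) ^ #E) * r ^ (2 * (D + 1 + 3 * m))) := h4
    _ ≤ (4 ^ r * (D + 1) ^ 2 * (n : ℝ) ^ 2) * ((2 : ℝ) ^ (1 / 100 * n : ℝ) *
      (r ^ (2 * (D + 1)) * 2 ^ (2 / 3 * n : ℝ))) := by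
        gcongr
        exact hball n A hAn
    _ = (4 ^ r * (D + 1) ^ 2 * r ^ (2 * (D + 1)) * (n : ℝ) ^ 2) *
      ((2 : ℝ) ^ (1 / 100 * n : ℝ) * 2 ^ (2 / 3 * n : ℝ)) := by ring
    _ ≤ (2 : ℝ) ^ (1 / 100 * n : ℝ) * ((2 : ℝ) ^ (1 / 100 * n : ℝ) * 2 ^ (2 / 3 * n : ℝ)) := by
        gcongr
    _ ≤ _ := by
        rw [← Real.rpow_add (by norm_num), ← Real.rpow_add (by norm_num)]
        refine Real.rpow_le_rpow_of_exponent_le (by norm_num) ?_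
        linarith

lemma card_two_colored_le {A : Finset ℕ} (c₀ : Fin r) (F : Finset (ℕ → Fin r))
    (hsupp : ∀ f ∈ F, ∀ y ∉ A, f y = c₀)
    (hF : ∀ f ∈ F, ∃ τ : Finset (Fin r), #τ = 2 ∧ ∀ x ∈ A, f x ∈ τ) :
    #F ≤ r.choose 2 * 2 ^ #A := by
  classical
  have h1 := card_le_sum_card_filter F (Finset.powersetCard 2 (Finset.univ : Finset (Fin r)))
    (fun τ f => ∀ x ∈ A, f x ∈ τ) (fun f hf => by
      obtain ⟨τ, hτ, h⟩ := hF f hf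
      exact ⟨τ, Finset.mem_powersetCard.2 ⟨Finset.subset_univ _, hτ⟩, h⟩)
  refine h1.trans ((Finset.sum_le_card_nsmul _ _ (2 ^ #A) fun τ hτ => ?_).trans ?_)
  · refine (card_le_prod_card _ A (fun _ => τ) (fun f hf => (Finset.mem_filter.1 hf).2) ?_).trans ?_
    · intro f hf g hg h
      funext y
      by_cases hy : y ∈ A
      · exact h y hy
      · rw [hsupp f (Finset.mem_filter.1 hf).1 y hy, hsupp g (Finset.mem_filter.1 hg).1 y hy]
    · rw [Finset.prod_const, (Finset.mem_powersetCard.1 hτ).2]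
  · simp

end Cases

section Assembly

variable {r n : ℕ} {A : Finset ℕ} {f : ℕ → Fin r}

lemma filter_popularTypes_eq_empty_subset (s : ℝ) (τ : Finset (Fin r)) :
    (A.filter fun v => popularTypes A f s v = ∅) ⊆ nearPeriods A f s τ := by
  intro v hv
  obtain ⟨hvA, h0⟩ := Finset.mem_filter.1 hv
  exact Finset.mem_filter.2 ⟨hvA, by simp [h0]⟩

/-- A coloring without two different near-period color pairs that is far from two-colored has
few elements without a popular color pair and many elements with at least two of them. -/
lemma many_popularTypes_of_far (hr : 3 ≤ r) {s b t : ℝ} (hs : 0 < s) (hb : 0 ≤ b)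
    (hf : RainbowSumFree A f)
    (hfar : ∀ τ : Finset (Fin r), #τ = 2 → t ≤ #(A.filter fun v => f v ∉ τ))
    (hper : ∀ τ₁ τ₂ : Finset (Fin r), #τ₁ = 2 → #τ₂ = 2 → τ₁ ≠ τ₂ →
      b < #(nearPeriods A f s τ₁) → (#(nearPeriods A f s τ₂) : ℝ) ≤ b) :
    (#(A.filter fun v => popularTypes A f s v = ∅) : ℝ) ≤ b ∧
      t - 2 ^ r * b ≤ #(A.filter fun v => 2 ≤ #(popularTypes A f s v)) := by
  have hcard : 1 < #(Finset.powersetCard 2 (Finset.univ : Finset (Fin r))) := by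
    rw [Finset.card_powersetCard, Finset.card_univ, Fintype.card_fin]
    calc 1 < Nat.choose 3 2 := by decide
      _ ≤ r.choose 2 := Nat.choose_le_choose 2 hr
  have hex : ∃ τ : Finset (Fin r), #τ = 2 ∧
      ∀ τ' : Finset (Fin r), #τ' = 2 → τ' ≠ τ → (#(nearPeriods A f s τ') : ℝ) ≤ b := by
    by_cases h : ∃ τ : Finset (Fin r), #τ = 2 ∧ b < #(nearPeriods A f s τ)
    · obtain ⟨τ, hτ, hlt⟩ := h
      exact ⟨τ, hτ, fun τ' hτ' hne => hper τ τ' hτ hτ' hne.symm hlt⟩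
    · push Not at h
      obtain ⟨τ, hτ⟩ := Finset.card_pos.1 (zero_lt_one.trans hcard)
      exact ⟨τ, (Finset.mem_powersetCard.1 hτ).2, fun τ' hτ' _ => h τ' hτ'⟩
  obtain ⟨τ, hτ, h⟩ := hex
  constructor
  · obtain ⟨e, he, hne⟩ := Finset.exists_mem_ne hcard τ
    refine le_trans ?_ (h e (Finset.mem_powersetCard.1 he).2 hne)
    exact_mod_cast Finset.card_le_card (filter_popularTypes_eq_empty_subset s e)
  · have := card_notMem_le hr hs hf hb h
    linarith [hfar τ hτ]

/-- A family of rainbow sum-free colorings of `A`, extended by a constant outside of `A`, is at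
most as large as the number of two-colored colorings plus an exponentially small error. -/
lemma card_rainbowSumFree_le (hr : 3 ≤ r) :
    ∃ c : ℝ, 0 < c ∧ ∀ᶠ n : ℕ in atTop, ∀ A, NearlyFull r n A →
      ∀ (c₀ : Fin r) (F : Finset (ℕ → Fin r)),
      (∀ f ∈ F, ∀ y ∉ A, f y = c₀) → (∀ f ∈ F, RainbowSumFree A f) →
      (#F : ℝ) ≤ r.choose 2 * 2 ^ #A + 3 * (2 : ℝ) ^ ((1 - c) * n) := by
  classical
  have hr' : (3 : ℝ) ≤ r := by exact_mod_cast hr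
  obtain ⟨ε, hε, hε1, hball⟩ := exists_sum_small_subsets_le (4 * r) (1 / 100) (by linarith)
    (by norm_num)
  have h2r : (1 : ℝ) ≤ 2 ^ r := one_le_pow₀ (by norm_num)
  set b : ℝ := ε / (8 * r * 2 ^ r) with hb
  set δ : ℝ := ε / (4 * 2 ^ r) with hδ
  have hb0 : 0 < b := by positivity
  have hδ0 : 0 < δ := by positivity
  have hδ1 : δ ≤ 1 := by
    rw [hδ, div_le_one (by positivity)]
    linarith
  have hδε : 4 * (2 ^ r * δ) ≤ ε := by
    apply le_of_eq
    rw [hδ]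
    field_simp
  have hb1 : b ≤ ε / 2 / (4 * r) := by
    rw [hb, div_div]
    refine div_le_div_of_nonneg_left hε.le (by positivity) ?_
    nlinarith
  have hb2 : 2 ^ r * b ≤ ε / 2 := by
    have : 2 ^ r * b = ε / (8 * r) := by
      rw [hb]
      field_simp
    rw [this]
    exact div_le_div_of_nonneg_left hε.le (by norm_num) (by linarith)
  obtain ⟨n₀, hn₀⟩ := card_le_of_many_popularTypes (by omega : 1 ≤ r) (ε / 2) δ (by positivity)
    hδ0 hδ1
  refine ⟨ε / 4, by positivity, ?_⟩
  filter_upwards [card_nearly_two_colored_le hr ε hball,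
    card_nearly_periodic_le hr ε δ b hδ0 hδε hb0 hball, eventually_ge_atTop n₀,
    eventually_ge_atTop 1] with n hI hII hn hn1 A hAf c₀ F hsupp hF
  have hn1' : (1 : ℝ) ≤ n := by exact_mod_cast hn1
  let P₀ : (ℕ → Fin r) → Prop := fun f => ∃ τ : Finset (Fin r), #τ = 2 ∧ ∀ x ∈ A, f x ∈ τ
  let P₁ : (ℕ → Fin r) → Prop := fun f => ∃ τ : Finset (Fin r), #τ = 2 ∧ (∃ x ∈ A, f x ∉ τ) ∧
    (#(A.filter fun v => f v ∉ τ) : ℝ) ≤ ε * n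
  let P₂ : (ℕ → Fin r) → Prop := fun f => ∃ τ₁ τ₂ : Finset (Fin r), #τ₁ = 2 ∧ #τ₂ = 2 ∧
    τ₁ ≠ τ₂ ∧ b * n < #(nearPeriods A f (δ * n) τ₁) ∧ b * n < #(nearPeriods A f (δ * n) τ₂)
  have hcover : F ⊆ (F.filter P₀ ∪ F.filter P₁) ∪
      (F.filter P₂ ∪ F.filter fun f => ¬ P₀ f ∧ ¬ P₁ f ∧ ¬ P₂ f) := by
    intro f hf
    simp only [Finset.mem_union, Finset.mem_filter, hf, true_and]
    tauto
  have hcount : #F ≤ (#(F.filter P₀) + #(F.filter P₁)) +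
      (#(F.filter P₂) + #(F.filter fun f => ¬ P₀ f ∧ ¬ P₁ f ∧ ¬ P₂ f)) :=
    (Finset.card_le_card hcover).trans ((Finset.card_union_le _ _).trans
      (add_le_add (Finset.card_union_le _ _) (Finset.card_union_le _ _)))
  have h0 : #(F.filter P₀) ≤ r.choose 2 * 2 ^ #A :=
    card_two_colored_le c₀ _ (fun f hf => hsupp f (Finset.mem_filter.1 hf).1)
      (fun f hf => (Finset.mem_filter.1 hf).2)
  have h1 := hI A hAf c₀ (F.filter P₁) (fun f hf => hsupp f (Finset.mem_filter.1 hf).1)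
    (fun f hf => hF f (Finset.mem_filter.1 hf).1) (fun f hf => (Finset.mem_filter.1 hf).2)
  have h2 := hII A hAf c₀ (F.filter P₂) (fun f hf => hsupp f (Finset.mem_filter.1 hf).1)
    (fun f hf => (Finset.mem_filter.1 hf).2)
  have hmany : ∀ f ∈ F.filter (fun f => ¬ P₀ f ∧ ¬ P₁ f ∧ ¬ P₂ f),
      (#(A.filter fun v => popularTypes A f (δ * n) v = ∅) : ℝ) ≤ b * n ∧
      ε * n - 2 ^ r * (b * n) ≤ #(A.filter fun v => 2 ≤ #(popularTypes A f (δ * n) v)) := by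
    intro f hf
    obtain ⟨hfF, n0, n1, n2⟩ := Finset.mem_filter.1 hf
    refine many_popularTypes_of_far hr (by positivity) (by positivity) (hF f hfF) ?_ ?_
    · intro τ hτ
      by_contra! hlt
      refine n1 ⟨τ, hτ, ?_, hlt.le⟩
      by_contra! hall
      exact n0 ⟨τ, hτ, hall⟩
    · intro τ₁ τ₂ c₁ c₂ hne hlt
      by_contra! hlt'
      exact n2 ⟨τ₁, τ₂, c₁, c₂, hne, hlt, hlt'⟩
  have h3 := hn₀ n hn A hAf.1 c₀ (F.filter fun f => ¬ P₀ f ∧ ¬ P₁ f ∧ ¬ P₂ f)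
    (fun f hf => hsupp f (Finset.mem_filter.1 hf).1)
    (fun f hf => hF f (Finset.mem_filter.1 hf).1)
    (fun f hf => (hmany f hf).1.trans (by gcongr))
    (fun f hf => le_trans (by nlinarith) (hmany f hf).2)
  have hexp : (2 : ℝ) ^ (3 / 4 * n : ℝ) ≤ 2 ^ ((1 - ε / 4) * n) := by
    refine Real.rpow_le_rpow_of_exponent_le (by norm_num) ?_
    gcongr
    linarith
  rw [show ε / 2 / 2 = ε / 4 by ring] at h3
  have h0' : (#(F.filter P₀) : ℝ) ≤ r.choose 2 * 2 ^ #A := by exact_mod_cast h0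
  have hcount' : (#F : ℝ) ≤ (#(F.filter P₀) + #(F.filter P₁)) +
      (#(F.filter P₂) + #(F.filter fun f => ¬ P₀ f ∧ ¬ P₁ f ∧ ¬ P₂ f)) := by
    exact_mod_cast hcount
  linarith

lemma nearlyFull_of_card_ge (hr : 1 ≤ r) (hA : A ⊆ Finset.Icc 1 n)
    (h : (1 - ((r : ℝ) ^ 3)⁻¹) * n ≤ #A) : NearlyFull r n A := by
  refine ⟨hA, ?_⟩
  have hAn : #A ≤ n := by simpa using Finset.card_le_card hA
  have hr0 : (0 : ℝ) < (r : ℝ) ^ 3 := by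
    have : (0 : ℝ) < r := by exact_mod_cast hr
    positivity
  have h1 : (r : ℝ) ^ 3 * ((n : ℝ) - #A) ≤ (n : ℝ) := by
    have h2 : ((n : ℝ) - #A) ≤ ((r : ℝ) ^ 3)⁻¹ * n := by linarith
    calc (r : ℝ) ^ 3 * ((n : ℝ) - #A) ≤ (r : ℝ) ^ 3 * (((r : ℝ) ^ 3)⁻¹ * (n : ℝ)) := by
          gcongr
      _ = (n : ℝ) := mul_inv_cancel_left₀ hr0.ne' _
  rw [← Nat.cast_sub hAn] at h1
  exact_mod_cast h1

lemma exists_finset_card_eq_numRSF (c₀ : Fin r) (A : Finset ℕ) :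
    ∃ F : Finset (ℕ → Fin r), numRSF r A = #F ∧ (∀ f ∈ F, ∀ y ∉ A, f y = c₀) ∧
      ∀ f ∈ F, RainbowSumFree A f := by
  classical
  let φ : {f : ↥A → Fin r // ∀ x y z : ↥A, (x : ℕ) + (y : ℕ) = (z : ℕ) →
      ¬(f x ≠ f y ∧ f x ≠ f z ∧ f y ≠ f z)} → ℕ → Fin r :=
    fun f y => if h : y ∈ A then f.1 ⟨y, h⟩ else c₀
  have hφ : Function.Injective φ := by
    intro f g hfg
    refine Subtype.ext (funext fun x => ?_)
    have := congrFun hfg x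
    simpa [φ] using this
  refine ⟨Finset.univ.image φ, ?_, ?_, ?_⟩
  · rw [Finset.card_image_of_injective _ hφ, Finset.card_univ, numRSF, Nat.card_eq_fintype_card]
  · intro f hf y hy
    obtain ⟨g, -, rfl⟩ := Finset.mem_image.1 hf
    simp [φ, hy]
  · intro f hf x hx y hy z hz hS
    obtain ⟨g, -, rfl⟩ := Finset.mem_image.1 hf
    simp only [φ, hx, hy, hz, dif_pos]
    rcases hS with h | h | h
    · have := g.2 ⟨x, hx⟩ ⟨y, hy⟩ ⟨z, hz⟩ h
      tauto
    · have := g.2 ⟨x, hx⟩ ⟨z, hz⟩ ⟨y, hy⟩ h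
      rw [eq_comm (a := g.1 ⟨y, hy⟩)]
      tauto
    · have := g.2 ⟨y, hy⟩ ⟨z, hz⟩ ⟨x, hx⟩ h
      rw [eq_comm (a := g.1 ⟨x, hx⟩), eq_comm (a := g.1 ⟨x, hx⟩)]
      tauto

end Assembly

theorem stmt_0 (r : ℕ) (hr : 3 ≤ r) :
    ∃ n₀ : ℕ, ∀ n : ℕ, n₀ < n → ∀ A ⊆ Finset.Icc 1 n,
      (1 - ((r : ℝ) ^ 3)⁻¹) * n ≤ (A.card : ℝ) →
      (numRSF r A : ℝ) ≤
        (r.choose 2 : ℝ) * 2 ^ A.card +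
          (2 : ℝ) ^ (-(n : ℝ) / (26 * Real.logb 2 n)) * 2 ^ n := by
  obtain ⟨c, hc, hev⟩ := card_rainbowSumFree_le hr
  obtain ⟨n₀, hn₀⟩ := eventually_atTop.1 (hev.and (eventually_three_mul_le c hc))
  refine ⟨n₀, fun n hn A hA hcard => ?_⟩
  obtain ⟨h1, h2⟩ := hn₀ n hn.le
  obtain ⟨F, hF, hsupp, hfree⟩ := exists_finset_card_eq_numRSF (⟨0, by omega⟩ : Fin r) A
  rw [hF]
  exact (h1 A (nearlyFull_of_card_ge (by omega) hA hcard) _ F hsupp hfree).trans (by gcongr)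
end

section
/- For every integer r ≥ 3, almost all rainbow sum-free r-colorings of [n] are 2-colorings; precisely, the ratio of the number of rainbow sum-free r-colorings of [n] that use at most two of the r colors to the total number of rainbow sum-free r-colorings of [n] tends to 1 as n → ∞. -/
open Finset

/-- The number of rainbow sum-free `r`-colorings of `A` that use at most two colors. -/
noncomputable def numRSF2 (r : ℕ) (A : Finset ℕ) : ℕ :=
  Nat.card {f : ↥A → Fin r //
    (∀ x y z : ↥A, (x : ℕ) + (y : ℕ) = (z : ℕ) →
      ¬(f x ≠ f y ∧ f x ≠ f z ∧ f y ≠ f z)) ∧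
    (Finset.univ.image f).card ≤ 2}

/-! Colorings of `[n]` are represented by functions `ℕ → Fin r` vanishing off `[n]` and are built
one element at a time. If `f` is not symmetric on `[z - 1]` (there are `x + y = z` with
`f x ≠ f y`), at most two colors are available at `z`; symmetric colorings of `[z - 1]` are
determined by their first half, hence are rare. Once three colors are present, some step within
a bounded window has at most one available color. -/

namespace RainbowSum

variable {r : ℕ}

/-- `f` has no rainbow sum in `[m]`. -/
def RainbowSumFree (m : ℕ) (f : ℕ → Fin r) : Prop :=
  ∀ x y, 1 ≤ x → 1 ≤ y → x + y ≤ m → ¬(f x ≠ f y ∧ f x ≠ f (x + y) ∧ f y ≠ f (x + y))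

/-- `f` is not invariant under the reflection `x ↦ z - x` of `[z - 1]`. -/
def Asymmetric (z : ℕ) (f : ℕ → Fin r) : Prop :=
  ∃ x y, 1 ≤ x ∧ 1 ≤ y ∧ x + y = z ∧ f x ≠ f y

/-- `f` takes at least three values on `[m]`. -/
def ThreeColored (m : ℕ) (f : ℕ → Fin r) : Prop :=
  ∃ a ∈ Icc 1 m, ∃ b ∈ Icc 1 m, ∃ c ∈ Icc 1 m, f a ≠ f b ∧ f a ≠ f c ∧ f b ≠ f c

lemma RainbowSumFree.mono {m n : ℕ} {f : ℕ → Fin r} (hf : RainbowSumFree m f) (h : n ≤ m) :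
    RainbowSumFree n f :=
  fun x y hx hy hxy => hf x y hx hy (hxy.trans h)

lemma RainbowSumFree.eq_or_eq {m x y : ℕ} {f : ℕ → Fin r} (hf : RainbowSumFree m f)
    (hx : 1 ≤ x) (hy : 1 ≤ y) (hm : x + y ≤ m) (hne : f x ≠ f y) :
    f (x + y) = f x ∨ f (x + y) = f y := by
  by_contra! h
  exact hf x y hx hy hm ⟨hne, h.1.symm, h.2.symm⟩

lemma RainbowSumFree.eq_of_two_pairs {m x y : ℕ} {f g : ℕ → Fin r} {u v : ℕ}
    (hf : RainbowSumFree m f) (hg : RainbowSumFree m g) (hx : 1 ≤ x) (hy : 1 ≤ y) (hu : 1 ≤ u)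
    (hv : 1 ≤ v) (h1 : x + y = m) (h2 : u + v = m)
    (hfg : ∀ i, 1 ≤ i → i < m → f i = g i) (hxy : f x ≠ f y) (huv : f u ≠ f v)
    (hyu : f y ≠ f u) (hyv : f y ≠ f v) : f m = g m := by
  have key : ∀ f : ℕ → Fin r, RainbowSumFree m f → f x ≠ f y → f u ≠ f v → f y ≠ f u →
      f y ≠ f v → f m = f x := by
    intro f hf hxy huv hyu hyv
    have e1 := hf.eq_or_eq hx hy h1.le hxy
    have e2 := hf.eq_or_eq hu hv h2.le huv
    rw [h1] at e1
    rw [h2] at e2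
    grind
  have ex := hfg x hx (by omega)
  have ey := hfg y hy (by omega)
  have eu := hfg u hu (by omega)
  have ev := hfg v hv (by omega)
  rw [key f hf hxy huv hyu hyv, ex]
  rw [ex, ey] at hxy
  rw [eu, ev] at huv
  rw [ey, eu] at hyu
  rw [ey, ev] at hyv
  exact (key g hg hxy huv hyu hyv).symm

lemma asymmetric_congr {z : ℕ} {f g : ℕ → Fin r} (h : ∀ i, 1 ≤ i → i < z → f i = g i) :
    Asymmetric z f ↔ Asymmetric z g := by
  have key : ∀ f g : ℕ → Fin r, (∀ i, 1 ≤ i → i < z → f i = g i) →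
      Asymmetric z f → Asymmetric z g := by
    rintro f g h ⟨x, y, hx, hy, hxy, hne⟩
    exact ⟨x, y, hx, hy, hxy, by rwa [← h x hx (by omega), ← h y hy (by omega)]⟩
  exact ⟨key f g h, key g f fun i h1 h2 => (h i h1 h2).symm⟩

lemma dependsOn_not_asymmetric (z : ℕ) :
    DependsOn (fun f : ℕ → Fin r => ¬Asymmetric z f) (Set.Icc 1 z) := fun f g h => by
  simp only [asymmetric_congr (z := z) (f := f) (g := g) fun i h1 h2 => h i ⟨h1, h2.le⟩]

lemma ThreeColored.exists_pair {m : ℕ} {f : ℕ → Fin r} (hf : ThreeColored m f) (c : Fin r) :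
    ∃ x y, 1 ≤ y ∧ y < x ∧ x ≤ m ∧ f x ≠ f y ∧ f x ≠ c ∧ f y ≠ c := by
  have key : ∀ a ∈ Icc 1 m, ∀ b ∈ Icc 1 m, f a ≠ f b → f a ≠ c → f b ≠ c →
      ∃ x y, 1 ≤ y ∧ y < x ∧ x ≤ m ∧ f x ≠ f y ∧ f x ≠ c ∧ f y ≠ c := by
    intro a ha b hb hab h1 h2
    rw [mem_Icc] at ha hb
    rcases lt_trichotomy a b with h | rfl | h
    · exact ⟨b, a, ha.1, h, hb.2, hab.symm, h2, h1⟩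
    · exact absurd rfl hab
    · exact ⟨a, b, hb.1, h, ha.2, hab, h1, h2⟩
  obtain ⟨x, hx, y, hy, z, hz, hxy, hxz, hyz⟩ := hf
  by_cases h1 : f x = c
  · exact key y hy z hz hyz (by rwa [← h1, ne_comm]) (by rwa [← h1, ne_comm])
  · by_cases h2 : f y = c
    · exact key x hx z hz hxz h1 (by rwa [← h2, ne_comm])
    · exact key x hx y hy hxy h1 h2

lemma dependsOn_threeColored (m : ℕ) :
    DependsOn (ThreeColored (r := r) m) (Set.Icc 1 m) := by
  have key : ∀ f g : ℕ → Fin r, (∀ i ∈ Set.Icc 1 m, f i = g i) →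
      ThreeColored m f → ThreeColored m g := by
    rintro f g h ⟨a, ha, b, hb, c, hc, hne⟩
    refine ⟨a, ha, b, hb, c, hc, ?_⟩
    rwa [← h a (mem_Icc.1 ha), ← h b (mem_Icc.1 hb), ← h c (mem_Icc.1 hc)]
  exact fun f g h => propext ⟨key f g h, key g f fun i hi => (h i hi).symm⟩

lemma ThreeColored.of_asymmetric {w n : ℕ} {f : ℕ → Fin r} (h : ThreeColored n f)
    (hf : RainbowSumFree n f) (hasym : ∀ z, w < z → z ≤ n → Asymmetric z f) :
    ThreeColored w f := by
  have key : ∀ z ∈ Icc 1 n, ∃ z' ∈ Icc 1 w, f z' = f z := by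
    intro z
    induction z using Nat.strong_induction_on with
    | _ z ih =>
    intro hz
    rw [mem_Icc] at hz
    rcases le_or_gt z w with hzw | hzw
    · exact ⟨z, mem_Icc.2 ⟨hz.1, hzw⟩, rfl⟩
    obtain ⟨x, y, hx, hy, rfl, hne⟩ := hasym z hzw hz.2
    rcases hf.eq_or_eq hx hy hz.2 hne with e | e
    · rw [e]
      exact ih x (by omega) (mem_Icc.2 ⟨hx, by omega⟩)
    · rw [e]
      exact ih y (by omega) (mem_Icc.2 ⟨hy, by omega⟩)
  obtain ⟨a, ha, b, hb, c, hc, hne⟩ := h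
  obtain ⟨a', ha', ea⟩ := key a ha
  obtain ⟨b', hb', eb⟩ := key b hb
  obtain ⟨c', hc', ec⟩ := key c hc
  exact ⟨a', ha', b', hb', c', hc', by rwa [ea, eb, ec]⟩

/-- `f` agrees with `g` on `[n]`. -/
def Agrees (g : ℕ → Fin r) (n : ℕ) (f : ℕ → Fin r) : Prop := ∀ i, 1 ≤ i → i ≤ n → f i = g i

lemma dependsOn_agrees (g : ℕ → Fin r) (n : ℕ) : DependsOn (Agrees g n) (Set.Icc 1 n) := by
  intro f f' h
  refine propext (forall_congr' fun i => forall_congr' fun h1 => forall_congr' fun h2 => ?_)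
  rw [h i ⟨h1, h2⟩]

lemma rainbowSumFree_iff {n : ℕ} (f : ℕ → Fin r) :
    RainbowSumFree n f ↔ ∀ x y z : Icc 1 n, (x : ℕ) + (y : ℕ) = (z : ℕ) →
      ¬(f x ≠ f y ∧ f x ≠ f z ∧ f y ≠ f z) := by
  constructor
  · rintro h ⟨x, hx⟩ ⟨y, hy⟩ ⟨_, hz⟩ rfl
    exact h x y (mem_Icc.1 hx).1 (mem_Icc.1 hy).1 (mem_Icc.1 hz).2
  · intro h x y hx hy hxy
    exact h ⟨x, mem_Icc.2 ⟨hx, by omega⟩⟩ ⟨y, mem_Icc.2 ⟨hy, by omega⟩⟩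
      ⟨x + y, mem_Icc.2 ⟨by omega, hxy⟩⟩ rfl

lemma not_threeColored_iff {n : ℕ} (f : ℕ → Fin r) :
    ¬ThreeColored n f ↔ #(univ.image fun i : Icc 1 n => f i) ≤ 2 := by
  rw [← not_lt, two_lt_card, not_iff_not]
  simp [ThreeColored]

variable [NeZero r]

/-- The restriction of `f` to `[m]`, extended by zero. -/
def truncate (m : ℕ) (f : ℕ → Fin r) : ℕ → Fin r :=
  fun i => if i ∈ Icc 1 m then f i else 0

open Classical in
/-- The functions on `ℕ` vanishing outside `[m]`. -/
noncomputable def colorings (r m : ℕ) [NeZero r] : Finset (ℕ → Fin r) :=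
  (univ : Finset (Icc 1 m → Fin r)).image fun f i => if h : i ∈ Icc 1 m then f ⟨i, h⟩ else 0

open Classical in
/-- The rainbow sum-free colorings of `[m]`. -/
noncomputable def sumFreeColorings (r m : ℕ) [NeZero r] : Finset (ℕ → Fin r) :=
  (colorings r m).filter (RainbowSumFree m)

open Classical in
/-- The rainbow sum-free colorings of `[m]` satisfying `Q` that are asymmetric at every `z` with
`n < z ≤ m`. -/
noncomputable def extensions (Q : (ℕ → Fin r) → Prop) (n m : ℕ) : Finset (ℕ → Fin r) :=
  (sumFreeColorings r m).filter fun f => Q f ∧ ∀ z, n < z → z ≤ m → Asymmetric z f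

lemma mem_colorings {m : ℕ} {f : ℕ → Fin r} :
    f ∈ colorings r m ↔ ∀ i, i ∉ Icc 1 m → f i = 0 := by
  classical
  simp only [colorings, mem_image, mem_univ, true_and]
  constructor
  · rintro ⟨g, rfl⟩ i hi
    simp only [hi, dite_false]
  · intro h
    refine ⟨fun i => f i, funext fun i => ?_⟩
    by_cases hi : i ∈ Icc 1 m
    · simp only [hi, dite_true]
    · simp only [hi, dite_false, h i hi]

lemma mem_sumFreeColorings {m : ℕ} {f : ℕ → Fin r} :
    f ∈ sumFreeColorings r m ↔ (∀ i, i ∉ Icc 1 m → f i = 0) ∧ RainbowSumFree m f := by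
  classical simp only [sumFreeColorings, mem_filter, mem_colorings]

lemma mem_extensions {Q : (ℕ → Fin r) → Prop} {n m : ℕ} {f : ℕ → Fin r} :
    f ∈ extensions Q n m ↔
      f ∈ sumFreeColorings r m ∧ Q f ∧ ∀ z, n < z → z ≤ m → Asymmetric z f := by
  classical simp only [extensions, mem_filter]

lemma truncate_apply {m i : ℕ} (f : ℕ → Fin r) (h1 : 1 ≤ i) (h2 : i ≤ m) :
    truncate m f i = f i := by
  simp [truncate, h1, h2]

lemma RainbowSumFree.truncate {m : ℕ} {f : ℕ → Fin r} (hf : RainbowSumFree m f) :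
    RainbowSumFree m (truncate m f) := by
  intro x y hx hy hxy
  rw [truncate_apply f hx (by omega), truncate_apply f hy (by omega),
    truncate_apply f (by omega) hxy]
  exact hf x y hx hy hxy

lemma truncate_mem_sumFreeColorings {m n : ℕ} {f : ℕ → Fin r} (hf : f ∈ sumFreeColorings r m)
    (h : n ≤ m) : truncate n f ∈ sumFreeColorings r n := by
  rw [mem_sumFreeColorings] at hf ⊢
  refine ⟨fun i hi => ?_, (hf.2.mono h).truncate⟩
  simp only [truncate, hi, if_false]

lemma ext_of_eqOn {m : ℕ} {f g : ℕ → Fin r} (hf : f ∈ sumFreeColorings r m)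
    (hg : g ∈ sumFreeColorings r m) (h : ∀ i, 1 ≤ i → i ≤ m → f i = g i) : f = g := by
  rw [mem_sumFreeColorings] at hf hg
  funext i
  by_cases hi : i ∈ Icc 1 m
  · rw [mem_Icc] at hi
    exact h i hi.1 hi.2
  · rw [hf.1 i hi, hg.1 i hi]

lemma ext_of_truncate_eq {m : ℕ} {f g : ℕ → Fin r} (hf : f ∈ sumFreeColorings r (m + 1))
    (hg : g ∈ sumFreeColorings r (m + 1)) (h : truncate m f = truncate m g)
    (h' : f (m + 1) = g (m + 1)) : f = g := by
  refine ext_of_eqOn hf hg fun i h1 h2 => ?_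
  rcases Nat.lt_or_ge m i with h3 | h3
  · obtain rfl : i = m + 1 := by omega
    exact h'
  · rw [← truncate_apply f h1 h3, h, truncate_apply g h1 h3]

lemma card_le_of_eq_of_truncate_eq {m : ℕ} {F G : Finset (ℕ → Fin r)}
    (hF : F ⊆ sumFreeColorings r (m + 1)) (hFG : ∀ f ∈ F, truncate m f ∈ G)
    (h : ∀ f ∈ F, ∀ g ∈ F, truncate m f = truncate m g → f (m + 1) = g (m + 1)) :
    #F ≤ #G :=
  card_le_card_of_injOn (truncate m) hFG fun f hf g hg hfg =>
    ext_of_truncate_eq (hF hf) (hF hg) hfg (h f hf g hg hfg)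

lemma card_le_two_mul {m : ℕ} {F G : Finset (ℕ → Fin r)}
    (hF : F ⊆ sumFreeColorings r (m + 1)) (hFG : ∀ f ∈ F, truncate m f ∈ G)
    (h : ∀ f ∈ F, Asymmetric (m + 1) f) : #F ≤ 2 * #G := by
  classical
  refine card_le_mul_card_image_of_maps_to hFG 2 fun g _ => ?_
  rcases (F.filter fun f => truncate m f = g).eq_empty_or_nonempty with h0 | ⟨f₀, hf₀⟩
  · simp [h0]
  rw [mem_filter] at hf₀
  obtain ⟨x, y, hx, hy, hxy, hne⟩ := h f₀ hf₀.1
  refine (card_le_card_of_injOn (t := {g x, g y}) (fun f => f (m + 1)) ?_ ?_).trans card_le_two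
  · intro f hf
    simp only [coe_filter, Set.mem_ofPred_eq] at hf
    have e : ∀ f' : ℕ → Fin r, truncate m f' = g → f' x = g x ∧ f' y = g y := by
      rintro f' rfl
      exact ⟨(truncate_apply f' hx (by omega)).symm, (truncate_apply f' hy (by omega)).symm⟩
    obtain ⟨e1, e2⟩ := e f hf.2
    obtain ⟨e3, e4⟩ := e f₀ hf₀.2
    have := (mem_sumFreeColorings.1 (hF hf.1)).2.eq_or_eq hx hy hxy.le
      (by rwa [e1, e2, ← e3, ← e4])
    rw [hxy, e1, e2] at this
    simpa using this
  · intro f hf f' hf' hff'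
    simp only [coe_filter, Set.mem_ofPred_eq] at hf hf'
    exact ext_of_truncate_eq (hF hf.1) (hF hf'.1) (hf.2.trans hf'.2.symm) hff'

lemma truncate_mem_extensions {Q : (ℕ → Fin r) → Prop} {n m k : ℕ}
    (hQ : DependsOn Q (Set.Icc 1 n)) (hnm : n ≤ m) (hmk : m ≤ k) {f : ℕ → Fin r}
    (hf : f ∈ extensions Q n k) : truncate m f ∈ extensions Q n m := by
  rw [mem_extensions] at hf ⊢
  refine ⟨truncate_mem_sumFreeColorings hf.1 hmk, ?_, fun z hz hzm => ?_⟩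
  · rw [hQ (y := f) fun i hi => truncate_apply f hi.1 (hi.2.trans hnm)]
    exact hf.2.1
  · exact (asymmetric_congr fun i h1 h2 => truncate_apply f h1 (by omega)).2
      (hf.2.2 z hz (by omega))

lemma card_extensions_add_le {Q : (ℕ → Fin r) → Prop} {n m : ℕ}
    (hQ : DependsOn Q (Set.Icc 1 n)) (hnm : n ≤ m) (j : ℕ) :
    #(extensions Q n (m + j)) ≤ 2 ^ j * #(extensions Q n m) := by
  induction j with
  | zero => simp
  | succ j ih =>
    have h : #(extensions Q n (m + j + 1)) ≤ 2 * #(extensions Q n (m + j)) := by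
      refine card_le_two_mul (m := m + j) (fun f hf => (mem_extensions.1 hf).1)
        (fun f hf => truncate_mem_extensions hQ (by omega) (by omega) hf) fun f hf => ?_
      exact (mem_extensions.1 hf).2.2 _ (by omega) le_rfl
    calc _ ≤ 2 * #(extensions Q n (m + j)) := h
      _ ≤ 2 * (2 ^ j * #(extensions Q n m)) := by gcongr
      _ = _ := by ring

/-! ### Symmetric prefixes -/

lemma card_symmetric_le (z : ℕ) :
    #(extensions (r := r) (fun f => ¬Asymmetric z f) z z) ≤ r * #(sumFreeColorings r (z / 2)) := by
  have := card_le_card_of_injOn (s := extensions (r := r) (fun f => ¬Asymmetric z f) z z)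
    (t := (univ : Finset (Fin r)) ×ˢ sumFreeColorings r (z / 2))
    (fun f => (f z, truncate (z / 2) f)) ?_ ?_
  · simpa using this
  · intro f hf
    simp only [coe_product, Set.mem_prod, mem_coe, mem_univ, true_and]
    exact truncate_mem_sumFreeColorings (mem_extensions.1 hf).1 (by omega)
  · intro f hf g hg hfg
    rw [mem_coe, mem_extensions] at hf hg
    simp only [Prod.mk.injEq] at hfg
    have half : ∀ i, 1 ≤ i → i ≤ z / 2 → f i = g i := fun i h1 h2 => by
      rw [← truncate_apply f h1 h2, hfg.2, truncate_apply g h1 h2]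
    have refl : ∀ f : ℕ → Fin r, ¬Asymmetric z f → ∀ i, 1 ≤ i → i < z → f i = f (z - i) := by
      intro f h i h1 h2
      by_contra hne
      exact h ⟨i, z - i, h1, by omega, by omega, hne⟩
    refine ext_of_eqOn hf.1 hg.1 fun i h1 h2 => ?_
    rcases h2.eq_or_lt with rfl | h2
    · exact hfg.1
    by_cases h3 : i ≤ z / 2
    · exact half i h1 h3
    · rw [refl f hf.2.1 i h1 h2, refl g hg.2.1 i h1 h2, half (z - i) (by omega) (by omega)]

lemma card_extensions_symmetric_le {z n : ℕ} (h : z ≤ n) :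
    #(extensions (r := r) (fun f => ¬Asymmetric z f) z n) ≤
      2 ^ (n - z) * (r * #(sumFreeColorings r (z / 2))) := by
  obtain ⟨j, rfl⟩ := Nat.exists_eq_add_of_le h
  rw [Nat.add_sub_cancel_left]
  exact (card_extensions_add_le (dependsOn_not_asymmetric z) le_rfl j).trans
    (Nat.mul_le_mul_left _ (card_symmetric_le z))

lemma exists_last_symmetric {m n : ℕ} {f : ℕ → Fin r} (hf : f ∈ sumFreeColorings r n)
    (h : ∃ z, m < z ∧ z ≤ n ∧ ¬Asymmetric z f) :
    ∃ z ∈ Ioc m n, f ∈ extensions (fun f => ¬Asymmetric z f) z n := by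
  classical
  obtain ⟨z, hz, hmax⟩ := ((Ioc m n).filter fun z => ¬Asymmetric z f).exists_maximal (by
    obtain ⟨z, h1, h2, h3⟩ := h
    exact ⟨z, by simp [h1, h2, h3]⟩)
  simp only [mem_filter, mem_Ioc] at hz hmax
  refine ⟨z, mem_Ioc.2 hz.1, mem_extensions.2 ⟨hf, hz.2, fun w hw hwn => ?_⟩⟩
  by_contra hsym
  have := hmax ⟨⟨by omega, hwn⟩, hsym⟩ hw.le
  omega

open Classical in
lemma card_symmetric_after_le (m n : ℕ) :
    #((sumFreeColorings r n).filter fun f => ∃ z, m < z ∧ z ≤ n ∧ ¬Asymmetric z f) ≤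
      ∑ z ∈ Ioc m n, 2 ^ (n - z) * (r * #(sumFreeColorings r (z / 2))) := by
  calc _ ≤ #((Ioc m n).biUnion fun z => extensions (r := r) (fun f => ¬Asymmetric z f) z n) := by
        refine card_le_card fun f hf => ?_
        rw [mem_filter] at hf
        exact mem_biUnion.2 (exists_last_symmetric hf.1 hf.2)
    _ ≤ ∑ z ∈ Ioc m n, #(extensions (r := r) (fun f => ¬Asymmetric z f) z n) := card_biUnion_le
    _ ≤ _ := sum_le_sum fun z hz => card_extensions_symmetric_le (mem_Ioc.1 hz).2

lemma sum_geometric_le (m n : ℕ) :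
    ∑ z ∈ Ioc m n, (7 / 8 : ℝ) ^ z ≤ 8 * (7 / 8) ^ m := by
  suffices h : ∀ n, m ≤ n → ∑ z ∈ Ioc m n, (7 / 8 : ℝ) ^ z = 7 * (7 / 8) ^ m - 7 * (7 / 8) ^ n by
    rcases le_total m n with hmn | hmn
    · rw [h n hmn]
      have h1 : (0 : ℝ) ≤ (7 / 8) ^ m := by positivity
      have h2 : (0 : ℝ) ≤ (7 / 8) ^ n := by positivity
      linarith
    · rw [Ioc_eq_empty (by omega), sum_empty]
      positivity
  intro n hn
  induction n, hn using Nat.le_induction with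
  | base => simp
  | succ n hn ih =>
    rw [← insert_Ioc_right_eq_Ioc_add_one hn, sum_insert (by simp), ih]
    ring

open Classical in
lemma card_symmetric_after_le_of_bound {K : ℝ} {m n : ℕ} (hK : 0 ≤ K)
    (h : ∀ i ≤ n / 2, (#(sumFreeColorings r i) : ℝ) ≤ K * 3 ^ i) :
    (#((sumFreeColorings r n).filter fun f => ∃ z, m < z ∧ z ≤ n ∧ ¬Asymmetric z f) : ℝ) ≤
      2 ^ n * (r * K * (8 * (7 / 8) ^ m)) := by
  calc _ ≤ ∑ z ∈ Ioc m n, (2 : ℝ) ^ (n - z) * (r * #(sumFreeColorings r (z / 2))) := by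
        exact_mod_cast card_symmetric_after_le (r := r) m n
    _ ≤ ∑ z ∈ Ioc m n, 2 ^ n * (r * K) * (7 / 8 : ℝ) ^ z := by
        refine sum_le_sum fun z hz => ?_
        rw [mem_Ioc] at hz
        have h1 : (3 : ℝ) ^ (z / 2) ≤ (7 / 4) ^ z := by
          calc (3 : ℝ) ^ (z / 2) ≤ ((7 / 4) ^ 2) ^ (z / 2) := by gcongr; norm_num
            _ = (7 / 4) ^ (2 * (z / 2)) := by rw [← pow_mul]
            _ ≤ (7 / 4) ^ z := pow_le_pow_right₀ (by norm_num) (by omega)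
        have h2 : (2 : ℝ) ^ n = 2 ^ (n - z) * 2 ^ z := by rw [← pow_add]; congr 1; omega
        calc (2 : ℝ) ^ (n - z) * (r * #(sumFreeColorings r (z / 2)))
            ≤ 2 ^ (n - z) * (r * (K * (7 / 4) ^ z)) := by
              gcongr
              exact (h _ (by omega)).trans (by gcongr)
          _ = 2 ^ n * (r * K) * (7 / 8 : ℝ) ^ z := by
              rw [h2, show (7 / 4 : ℝ) = 2 * (7 / 8) by norm_num, mul_pow]
              ring
    _ ≤ 2 ^ n * (r * K) * (8 * (7 / 8) ^ m) := by
        rw [← mul_sum]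
        gcongr
        exact sum_geometric_le m n
    _ = _ := by ring

variable (r) in
lemma exists_card_le : ∃ K : ℝ, 0 ≤ K ∧ ∀ n, (#(sumFreeColorings r n) : ℝ) ≤ K * 3 ^ n := by
  classical
  obtain ⟨n₀, hn₀⟩ : ∃ n₀ : ℕ, (8 * r : ℝ) < (3 / 2) ^ n₀ :=
    pow_unbounded_of_one_lt _ (by norm_num)
  obtain ⟨K, hK0, hK⟩ :
      ∃ K : ℝ, 0 ≤ K ∧ ∀ i < n₀ + 1, (#(sumFreeColorings r i) : ℝ) ≤ K :=
    ⟨∑ i ∈ range (n₀ + 1), (#(sumFreeColorings r i) : ℝ), sum_nonneg fun i _ => Nat.cast_nonneg _,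
      fun i hi => single_le_sum (f := fun i => (#(sumFreeColorings r i) : ℝ))
        (fun i _ => Nat.cast_nonneg _) (mem_range.2 hi)⟩
  refine ⟨K, hK0, fun n => ?_⟩
  induction n using Nat.strong_induction_on with
  | _ n ih =>
  rcases Nat.lt_or_ge n (n₀ + 1) with h | h
  · exact (hK n h).trans (le_mul_of_one_le_right hK0 (one_le_pow₀ (by norm_num)))
  · have h1 := card_symmetric_after_le_of_bound (r := r) (m := 0) (n := n) hK0
      fun i hi => ih i (by omega)
    rw [filter_true_of_mem fun f _ => ⟨1, by omega, by omega, by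
      rintro ⟨x, y, hx, hy, hxy, -⟩; omega⟩] at h1
    have h2 : (8 * r : ℝ) ≤ (3 / 2) ^ n :=
      hn₀.le.trans (pow_le_pow_right₀ (by norm_num) (by omega))
    calc _ ≤ (2 : ℝ) ^ n * (r * K * (8 * (7 / 8) ^ 0)) := h1
      _ = 2 ^ n * K * (8 * r) := by ring
      _ ≤ 2 ^ n * K * (3 / 2) ^ n := by gcongr
      _ = K * 3 ^ n := by
        rw [div_pow]
        field_simp

/-! ### Three colors -/

lemma card_extensions_agrees_le (g : ℕ → Fin r) (n j : ℕ) :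
    #(extensions (Agrees g n) n (n + j)) ≤ 2 ^ j := by
  refine (card_extensions_add_le (dependsOn_agrees g n) le_rfl j).trans
    (mul_le_of_le_one_right' (card_le_one.2 fun f hf f' hf' => ?_))
  rw [mem_extensions] at hf hf'
  exact ext_of_eqOn hf.1 hf'.1 fun i h1 h2 => (hf.2.1 i h1 h2).trans (hf'.2.1 i h1 h2).symm

/-- Prescribe the color at `n + i + 1`: if it is not `g y`, then the color at `n + i + 1 + y` is
forced by the pairs `(x, n)` and `(y, n + i + 1)`. -/
lemma card_extensions_agrees_le_of_pair {g : ℕ → Fin r} {n i y : ℕ} (hy : 1 ≤ y)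
    (hx : i + 1 + y ≤ n) (hxy : g (i + 1 + y) ≠ g y) (hxn : g (i + 1 + y) ≠ g n)
    (hyn : g y ≠ g n) :
    4 * #(extensions (Agrees g n) n (n + i + 1 + y)) ≤ 3 * 2 ^ (i + 1 + y) := by
  classical
  obtain ⟨t, rfl⟩ : ∃ t, y = t + 1 := ⟨y - 1, by omega⟩
  set x := i + 1 + (t + 1) with hx_def
  let P : Prop → (ℕ → Fin r) → Prop := fun p f =>
    (Agrees g n f ∧ ∀ z, n < z → z ≤ n + i + 1 → Asymmetric z f) ∧
      (f (n + i + 1) = g (t + 1) ↔ p)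
  have hP : ∀ p, DependsOn (P p) (Set.Icc 1 (n + i + 1)) := by
    intro p f f' h
    have e1 : Agrees g n f = Agrees g n f' :=
      dependsOn_agrees g n fun j hj => h j ⟨hj.1, by have := hj.2; omega⟩
    have e2 : ∀ z, z ≤ n + i + 1 → (Asymmetric z f ↔ Asymmetric z f') := fun z hz =>
      asymmetric_congr fun j h1 h2 => h j ⟨h1, by omega⟩
    have e3 := h (n + i + 1) ⟨by omega, le_rfl⟩
    simp only [P, e1, e3]
    congr 2
    refine propext (forall_congr' fun z => forall_congr' fun _ => forall_congr' fun hz => ?_)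
    rw [e2 z hz]
  have split : ∀ j, #(extensions (Agrees g n) n (n + i + 1 + j)) =
      #(extensions (P True) (n + i + 1) (n + i + 1 + j)) +
        #(extensions (P False) (n + i + 1) (n + i + 1 + j)) := by
    intro j
    rw [← card_filter_add_card_filter_not (s := extensions (Agrees g n) n (n + i + 1 + j))
      (fun f => f (n + i + 1) = g (t + 1))]
    have hz : ∀ f : ℕ → Fin r, (∀ z, n < z → z ≤ n + i + 1 + j → Asymmetric z f) ↔
        (∀ z, n < z → z ≤ n + i + 1 → Asymmetric z f) ∧
        (∀ z, n + i + 1 < z → z ≤ n + i + 1 + j → Asymmetric z f) := fun f =>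
      ⟨fun h => ⟨fun z h1 h2 => h z h1 (by omega), fun z h1 h2 => h z (by omega) h2⟩,
        fun h z h1 h2 => (le_or_gt z (n + i + 1)).elim (h.1 z h1) fun h3 => h.2 z h3 h2⟩
    congr 2
    · ext f
      simp only [mem_filter, mem_extensions, P, hz, iff_true]
      tauto
    · ext f
      simp only [mem_filter, mem_extensions, P, hz, iff_false]
      tauto
  have hT0 : #(extensions (P True) (n + i + 1) (n + i + 1)) ≤ 2 ^ i := by
    refine (card_le_of_eq_of_truncate_eq (m := n + i) (G := extensions (Agrees g n) n (n + i))
      (fun f hf => (mem_extensions.1 hf).1) (fun f hf => ?_) fun f hf f' hf' _ => ?_).trans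
      (card_extensions_agrees_le g n i)
    · refine truncate_mem_extensions (k := n + i + 1) (dependsOn_agrees g n) (by omega) (by omega) ?_
      rw [mem_extensions] at hf ⊢
      exact ⟨hf.1, hf.2.1.1⟩
    · rw [mem_extensions] at hf hf'
      rw [hf.2.1.2.2 trivial, hf'.2.1.2.2 trivial]
  have hT := card_extensions_add_le (hP True) le_rfl (t + 1)
  have hF := card_extensions_add_le (hP False) le_rfl t
  have hF1 : #(extensions (P False) (n + i + 1) (n + i + 1 + (t + 1))) ≤
      #(extensions (P False) (n + i + 1) (n + i + 1 + t)) := by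
    refine card_le_of_eq_of_truncate_eq (m := n + i + 1 + t)
      (fun f hf => (mem_extensions.1 hf).1)
      (fun f hf => truncate_mem_extensions (hP False) (by omega) (by omega) hf)
      fun f hf f' hf' hff' => ?_
    rw [mem_extensions] at hf hf'
    obtain ⟨hf1, ⟨⟨hag, -⟩, hne⟩, -⟩ := hf
    have hne' : f (n + i + 1) ≠ g (t + 1) := by simpa using hne
    have ax : f x = g x := hag x (by omega) (by omega)
    have ay : f (t + 1) = g (t + 1) := hag _ hy (by omega)
    have an : f n = g n := hag n (by omega) le_rfl
    refine (mem_sumFreeColorings.1 hf1).2.eq_of_two_pairs (x := n + i + 1) (y := t + 1) (u := x)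
      (v := n) (mem_sumFreeColorings.1 hf'.1).2 (by omega) hy (by omega) (by omega)
      (by omega) (by omega) (fun j h1 h2 => ?_) ?_ ?_ ?_ ?_
    · rw [← truncate_apply f h1 (m := n + i + 1 + t) (by omega), hff',
        truncate_apply f' h1 (by omega)]
    · rwa [ay]
    · rwa [ax, an]
    · rw [ay, ax]
      exact hxy.symm
    · rwa [ay, an]
  have h0 := split 0
  have htot : #(extensions (Agrees g n) n (n + i + 1 + 0)) ≤ 2 ^ (i + 1) :=
    card_extensions_agrees_le g n (i + 1)
  rw [split (t + 1)]
  rw [Nat.add_zero] at h0 htot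
  set a := #(extensions (P True) (n + i + 1) (n + i + 1))
  set b := #(extensions (P False) (n + i + 1) (n + i + 1))
  have hab : 2 * a + b ≤ 3 * 2 ^ i := by
    rw [pow_succ] at htot
    omega
  calc _ ≤ 4 * (2 ^ (t + 1) * a + 2 ^ t * b) := by gcongr; exact hF1.trans hF
    _ = 4 * (2 ^ t * (2 * a + b)) := by ring
    _ ≤ 4 * (2 ^ t * (3 * 2 ^ i)) := by gcongr
    _ = 3 * 2 ^ x := by rw [hx_def]; ring

lemma card_extensions_agrees_le_of_threeColored {g : ℕ → Fin r} {w n : ℕ} (hwn : w ≤ n)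
    (hg : ThreeColored w g) : 4 * #(extensions (Agrees g n) n (n + w)) ≤ 3 * 2 ^ w := by
  obtain ⟨x, y, hy, hyx, hxw, hxy, hxn, hyn⟩ := hg.exists_pair (g n)
  obtain ⟨i, rfl⟩ : ∃ i, x = i + 1 + y := ⟨x - y - 1, by omega⟩
  obtain ⟨j, rfl⟩ := Nat.exists_eq_add_of_le hxw
  have h := card_extensions_agrees_le_of_pair hy (hxw.trans hwn) hxy hxn hyn
  have h' := card_extensions_add_le (dependsOn_agrees g n) (m := n + i + 1 + y) (by omega) j
  rw [show n + (i + 1 + y + j) = n + i + 1 + y + j by ring]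
  calc _ ≤ 4 * (2 ^ j * #(extensions (Agrees g n) n (n + i + 1 + y))) := by gcongr
    _ = 2 ^ j * (4 * #(extensions (Agrees g n) n (n + i + 1 + y))) := by ring
    _ ≤ 2 ^ j * (3 * 2 ^ (i + 1 + y)) := by gcongr
    _ = _ := by ring

lemma card_extensions_threeColored_add_le {w n : ℕ} (hwn : w ≤ n) :
    4 * #(extensions (r := r) (ThreeColored w) w (n + w)) ≤
      3 * 2 ^ w * #(extensions (r := r) (ThreeColored w) w n) := by
  classical
  rw [card_eq_sum_card_fiberwise (f := truncate n) (t := extensions (r := r) (ThreeColored w) w n)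
    fun f hf => truncate_mem_extensions (dependsOn_threeColored w) hwn (by omega) hf, mul_sum,
    mul_comm, ← smul_eq_mul, ← sum_const]
  refine sum_le_sum fun g hg => ?_
  refine le_trans ?_ (card_extensions_agrees_le_of_threeColored hwn (mem_extensions.1 hg).2.1)
  gcongr
  intro f hf
  rw [mem_filter, mem_extensions] at hf
  obtain ⟨⟨hf, -, hz⟩, rfl⟩ := hf
  exact mem_extensions.2 ⟨hf, fun i h1 h2 => (truncate_apply f h1 h2).symm,
    fun z h1 h2 => hz z (by omega) h2⟩

lemma card_extensions_threeColored_le (w t s : ℕ) :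
    (#(extensions (r := r) (ThreeColored w) w (w + t * w + s)) : ℝ) ≤
      (3 / 4) ^ t * 2 ^ (w + t * w + s) * #(extensions (r := r) (ThreeColored w) w w) := by
  have h : ∀ t, (#(extensions (r := r) (ThreeColored w) w (w + t * w)) : ℝ) ≤
      (3 / 4) ^ t * 2 ^ (t * w) * #(extensions (r := r) (ThreeColored w) w w) := by
    intro t
    induction t with
    | zero => simp
    | succ t ih =>
      have h1 : (4 * #(extensions (r := r) (ThreeColored w) w (w + t * w + w)) : ℝ) ≤
          3 * 2 ^ w * #(extensions (r := r) (ThreeColored w) w (w + t * w)) := by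
        exact_mod_cast card_extensions_threeColored_add_le (r := r) (w := w) (n := w + t * w)
          (by omega)
      rw [show w + (t + 1) * w = w + t * w + w by ring]
      calc _ ≤ (3 / 4) * 2 ^ w * (#(extensions (r := r) (ThreeColored w) w (w + t * w)) : ℝ) := by
            linarith
        _ ≤ (3 / 4) * 2 ^ w *
            ((3 / 4) ^ t * 2 ^ (t * w) * #(extensions (r := r) (ThreeColored w) w w)) := by gcongr
        _ = _ := by ring
  have h1 : (#(extensions (r := r) (ThreeColored w) w (w + t * w + s)) : ℝ) ≤
      2 ^ s * #(extensions (r := r) (ThreeColored w) w (w + t * w)) := by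
    exact_mod_cast card_extensions_add_le (dependsOn_threeColored w) (by omega) s
  calc _ ≤ (2 : ℝ) ^ s * #(extensions (r := r) (ThreeColored w) w (w + t * w)) := h1
    _ ≤ 2 ^ s * ((3 / 4) ^ t * 2 ^ (t * w) * #(extensions (r := r) (ThreeColored w) w w)) := by
      gcongr
      exact h t
    _ = (3 / 4) ^ t * 2 ^ (t * w + s) * #(extensions (r := r) (ThreeColored w) w w) := by ring
    _ ≤ _ := by
      gcongr
      · norm_num
      · omega

open Classical in
lemma card_threeColored_le (w n : ℕ) :
    #((sumFreeColorings r n).filter (ThreeColored n)) ≤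
      #(extensions (r := r) (ThreeColored w) w n) +
        #((sumFreeColorings r n).filter fun f => ∃ z, w < z ∧ z ≤ n ∧ ¬Asymmetric z f) := by
  refine (card_le_card fun f hf => ?_).trans (card_union_le _ _)
  rw [mem_filter] at hf
  rw [mem_union, mem_filter]
  by_cases h : ∃ z, w < z ∧ z ≤ n ∧ ¬Asymmetric z f
  · exact Or.inr ⟨hf.1, h⟩
  · push Not at h
    exact Or.inl (mem_extensions.2
      ⟨hf.1, hf.2.of_asymmetric (mem_sumFreeColorings.1 hf.1).2 h, h⟩)

open Classical Filter Topology in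
variable (r) in
lemma tendsto_card_threeColored_div :
    Tendsto (fun n => (#((sumFreeColorings r n).filter (ThreeColored n)) : ℝ) / 2 ^ n) atTop
      (𝓝 0) := by
  obtain ⟨K, hK, hbound⟩ := exists_card_le r
  rw [Metric.tendsto_atTop]
  intro ε hε
  have hlim : ∀ (C q : ℝ), 0 ≤ q → q < 1 → ∃ m : ℕ, 0 < m ∧ C * q ^ m < ε / 2 := by
    intro C q h0 h1
    have h := (tendsto_pow_atTop_nhds_zero_of_lt_one h0 h1).const_mul C
    rw [mul_zero] at h
    obtain ⟨m, hm, hm0⟩ := ((h.eventually_lt_const (half_pos hε)).and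
      (eventually_gt_atTop 0)).exists
    exact ⟨m, hm0, hm⟩
  obtain ⟨w, hw, hw'⟩ := hlim (r * K * 8) (7 / 8) (by norm_num) (by norm_num)
  obtain ⟨t, -, ht⟩ := hlim #(extensions (r := r) (ThreeColored w) w w) (3 / 4) (by norm_num)
    (by norm_num)
  refine ⟨w + t * w, fun n hn => ?_⟩
  obtain ⟨s, rfl⟩ := Nat.exists_eq_add_of_le hn
  set n := w + t * w + s
  have h1 : (#((sumFreeColorings r n).filter (ThreeColored n)) : ℝ) ≤
      #(extensions (r := r) (ThreeColored w) w n) +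
        #((sumFreeColorings r n).filter fun f => ∃ z, w < z ∧ z ≤ n ∧ ¬Asymmetric z f) := by
    exact_mod_cast card_threeColored_le (r := r) w n
  have h2 := card_extensions_threeColored_le (r := r) w t s
  have h3 := card_symmetric_after_le_of_bound (r := r) (m := w) (n := n) hK fun i _ => hbound i
  have hpos : (0 : ℝ) < 2 ^ n := by positivity
  rw [Real.dist_eq, sub_zero, abs_of_nonneg (by positivity), div_lt_iff₀ hpos]
  have h4 := mul_lt_mul_of_pos_right hw' hpos
  have h5 := mul_lt_mul_of_pos_right ht hpos
  linarith

/-! ### Comparison with the total number of colorings -/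

lemma two_pow_le_card (hr : 2 ≤ r) (n : ℕ) : 2 ^ n ≤ #(sumFreeColorings r n) := by
  have h01 : (0 : Fin r) ≠ ⟨1, hr⟩ := by
    rw [Ne, Fin.ext_iff]
    simp
  rw [show 2 ^ n = #(Icc 1 n).powerset by simp]
  refine card_le_card_of_injOn (fun s i => if i ∈ s then ⟨1, hr⟩ else 0) ?_ ?_
  · intro s hs
    rw [coe_powerset, Set.mem_preimage, Set.mem_powerset_iff, coe_subset] at hs
    refine mem_sumFreeColorings.2 ⟨fun i hi => if_neg fun h => hi (hs h), fun x y _ _ _ => ?_⟩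
    beta_reduce
    grind
  · intro s _ t _ hst
    ext i
    have := congrFun hst i
    by_cases h1 : i ∈ s <;> by_cases h2 : i ∈ t <;> simp_all

lemma natCard_subtype_eq {n : ℕ} {p : (Icc 1 n → Fin r) → Prop} {q : (ℕ → Fin r) → Prop}
    [DecidablePred q] (h : ∀ f, q f ↔ p fun i => f i) :
    Nat.card {f // p f} = #((colorings r n).filter q) := by
  classical
  have hext : ∀ f : Icc 1 n → Fin r,
      (fun i : Icc 1 n => if h : (i : ℕ) ∈ Icc 1 n then f ⟨i, h⟩ else 0) = f := fun f =>
    funext fun i => by simp only [i.2, dite_true]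
  rw [colorings, filter_image, card_image_of_injective]
  · refine Nat.subtype_card _ fun f => ?_
    rw [mem_filter, h, hext]
    simp
  · intro f g hfg
    rw [← hext f, ← hext g]
    exact funext fun i => congrFun hfg i

lemma numRSF_eq (n : ℕ) : numRSF r (Icc 1 n) = #(sumFreeColorings r n) := by
  classical
  rw [sumFreeColorings]
  exact natCard_subtype_eq rainbowSumFree_iff

open Classical in
lemma numRSF2_eq (n : ℕ) :
    numRSF2 r (Icc 1 n) = #((sumFreeColorings r n).filter fun f => ¬ThreeColored n f) := by
  rw [sumFreeColorings, filter_filter]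
  refine natCard_subtype_eq (r := r) fun f => ?_
  rw [rainbowSumFree_iff, not_threeColored_iff]

end RainbowSum

theorem stmt_1 (r : ℕ) (hr : 3 ≤ r) :
    Filter.Tendsto
      (fun n : ℕ =>
        (numRSF2 r (Finset.Icc 1 n) : ℝ) / (numRSF r (Finset.Icc 1 n) : ℝ))
      Filter.atTop (nhds 1) := by
  classical
  have : NeZero r := ⟨by omega⟩
  have hcard (n : ℕ) : (2 : ℝ) ^ n ≤ #(RainbowSum.sumFreeColorings r n) := by
    exact_mod_cast RainbowSum.two_pow_le_card (by omega) n
  have hpos (n : ℕ) : (0 : ℝ) < #(RainbowSum.sumFreeColorings r n) :=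
    lt_of_lt_of_le (by positivity) (hcard n)
  have hlim : Filter.Tendsto (fun n =>
      (#((RainbowSum.sumFreeColorings r n).filter (RainbowSum.ThreeColored n)) : ℝ) /
        #(RainbowSum.sumFreeColorings r n)) Filter.atTop (nhds 0) :=
    squeeze_zero (fun n => by positivity)
      (fun n => div_le_div_of_nonneg_left (by positivity) (by positivity) (hcard n))
      (RainbowSum.tendsto_card_threeColored_div r)
  have h := hlim.const_sub 1
  rw [sub_zero] at h
  refine h.congr fun n => ?_
  rw [RainbowSum.numRSF_eq, RainbowSum.numRSF2_eq, eq_div_iff (hpos n).ne', sub_mul, one_mul,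
    div_mul_cancel₀ _ (hpos n).ne', sub_eq_iff_eq_add', ← Nat.cast_add,
    card_filter_add_card_filter_not]
end

section
/- There exists n₀ such that for all n > n₀, among all subsets of [n], the interval [n] itself is the unique rainbow 3-extremal set; that is, g([n], 3) = g(n, 3), and every A ⊆ [n] with A ≠ [n] satisfies g(A, 3) < g([n], 3). -/
open Finset

section Auxiliary

/-- The coloring `f` of `A` has no rainbow sum. -/
def IsRSF (A : Finset ℕ) (f : ↥A → Fin 3) : Prop :=
  ∀ x y z : ↥A, (x : ℕ) + (y : ℕ) = (z : ℕ) → ¬(f x ≠ f y ∧ f x ≠ f z ∧ f y ≠ f z)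

open Classical in
/-- The finset of rainbow sum-free `3`-colorings of `A`. -/
noncomputable def rsf (A : Finset ℕ) : Finset (↥A → Fin 3) := univ.filter (IsRSF A)

theorem numRSF_three_eq_card_rsf (A : Finset ℕ) : numRSF 3 A = #(rsf A) := by
  classical
  unfold numRSF rsf IsRSF
  rw [Nat.card_eq_fintype_card, Fintype.card_subtype]
  congr!

theorem two_mul_two_pow_le_card_rsf_Icc (n : ℕ) : 2 * 2 ^ n ≤ #(rsf (Icc 1 n)) + 1 := by
  classical
  let G : Fin 3 → Finset (↥(Icc 1 n) → Fin 3) := fun c => Fintype.piFinset fun _ => univ.erase c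
  have hcard : ∀ c, #(G c) = 2 ^ n := fun c => by simp [G, Fintype.card_piFinset]
  have hsub : G 1 ∪ G 2 ⊆ rsf (Icc 1 n) := by
    intro f hf
    simp only [G, mem_union, Fintype.mem_piFinset, mem_erase, mem_univ, and_true] at hf
    simp only [rsf, mem_filter, mem_univ, true_and]
    intro x y z _
    rcases hf with h | h <;> have h1 := h x <;> have h2 := h y <;> have h3 := h z <;> omega
  have hinter : #(G 1 ∩ G 2) ≤ 1 := by
    rw [card_le_one]
    intro f hf g hg
    simp only [G, mem_inter, Fintype.mem_piFinset, mem_erase, mem_univ, and_true] at hf hg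
    funext x
    have h1 := hf.1 x
    have h2 := hf.2 x
    have h3 := hg.1 x
    have h4 := hg.2 x
    omega
  have h1 := card_union_add_card_inter (G 1) (G 2)
  have h2 := card_le_card hsub
  rw [hcard, hcard] at h1
  omega

/-- The number of subsets of size at most `M` of a finite set. -/
theorem card_filter_powerset_card_le {α : Type*} (X : Finset α) (M : ℕ) :
    #(X.powerset.filter fun S => #S ≤ M) ≤ (#X + 1) ^ M := by
  classical
  have h : (X.powerset.filter fun S => #S ≤ M) ⊆
      (range (M + 1)).biUnion fun i => X.powersetCard i := by
    intro S hS
    simp only [mem_filter, mem_powerset] at hS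
    simp only [mem_biUnion, mem_range, mem_powersetCard]
    exact ⟨#S, by omega, hS.1, rfl⟩
  refine (card_le_card h).trans (card_biUnion_le.trans ?_)
  rw [add_pow]
  refine sum_le_sum fun i hi => ?_
  rw [card_powersetCard, one_pow, mul_one]
  refine (Nat.choose_le_pow _ _).trans (Nat.le_mul_of_pos_right _ (Nat.choose_pos ?_))
  simpa [Nat.lt_succ_iff] using hi

/-! ### Colorings with a small color class -/

/-- The elements of `A \ S` whose color is not forced, given an element `x ∈ S`, by that of a
smaller element of `A \ S`. -/
def freeElts (A S : Finset ℕ) (x : ℕ) : Finset ℕ :=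
  (A \ S).filter fun y => ¬∃ w ∈ A \ S, w < y ∧ (w + y = x ∨ w + x = y)

theorem card_freeElts_le {n : ℕ} {A S : Finset ℕ} (hA : A ⊆ Icc 1 n) {x : ℕ} (hxA : x ∈ A)
    (hx : x ∈ S) : 6 * #(freeElts A S x) ≤ 5 * n := by
  have hU : A \ S ⊆ Icc 1 n := sdiff_subset.trans hA
  have hxn := mem_Icc.1 (hA hxA)
  have hN : #(Icc 1 n \ (A \ S)) + #(A \ S) = n := by
    rw [card_sdiff_add_card_eq_card hU]; simp
  have h1 : #(freeElts A S x) ≤ #(A \ S) := card_filter_le _ _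
  have h2 : freeElts A S x ⊆ Icc 1 (x / 2) ∪ ((Icc 1 n \ (A \ S)).image (fun w => x - w) ∪
      (Icc 1 n \ (A \ S)).image fun w => x + w) := by
    intro y hy
    simp only [freeElts, mem_filter] at hy
    obtain ⟨hyU, hno⟩ := hy
    have hyn := mem_Icc.1 (hU hyU)
    have hne : y ≠ x := by
      rintro rfl
      exact (mem_sdiff.1 hyU).2 hx
    simp only [mem_union, mem_image]
    by_cases h : 2 * y ≤ x
    · left; rw [mem_Icc]; omega
    · right
      rcases lt_or_gt_of_ne hne with hlt | hlt
      · refine Or.inl ⟨x - y, mem_sdiff.2 ⟨mem_Icc.2 (by omega), fun hw => hno ?_⟩, by omega⟩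
        exact ⟨x - y, hw, by omega, by omega⟩
      · refine Or.inr ⟨y - x, mem_sdiff.2 ⟨mem_Icc.2 (by omega), fun hw => hno ?_⟩, by omega⟩
        exact ⟨y - x, hw, by omega, by omega⟩
  have h3 := card_le_card h2
  have h4 := card_union_le (Icc 1 (x / 2)) ((Icc 1 n \ (A \ S)).image (fun w => x - w) ∪
      (Icc 1 n \ (A \ S)).image fun w => x + w)
  have h5 := card_union_le ((Icc 1 n \ (A \ S)).image (fun w => x - w))
      ((Icc 1 n \ (A \ S)).image fun w => x + w)
  have h6 : #((Icc 1 n \ (A \ S)).image (fun w => x - w)) ≤ _ := card_image_le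
  have h7 : #((Icc 1 n \ (A \ S)).image (fun w => x + w)) ≤ _ := card_image_le
  have h8 : #(Icc 1 (x / 2)) = x / 2 := by simp
  omega

open Classical in
theorem card_rsf_filter_class_eq_le {n : ℕ} {A S : Finset ℕ} (hA : A ⊆ Icc 1 n) (hS : S ⊆ A)
    (hne : S.Nonempty) (c : Fin 3) :
    #((rsf A).filter fun f => ∀ x : ↥A, f x = c ↔ (x : ℕ) ∈ S) ≤ 2 ^ (5 * n / 6) := by
  obtain ⟨x, hx⟩ := hne
  set D := freeElts A S x with hD
  have hDA : D ⊆ A := (filter_subset _ _).trans sdiff_subset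
  have hcard : #(Fintype.piFinset fun y : ↥A =>
      if (y : ℕ) ∈ D then (univ.erase c : Finset (Fin 3)) else {c}) = 2 ^ #D := by
    rw [Fintype.card_piFinset]
    have : ∀ y : ↥A, #(if (y : ℕ) ∈ D then (univ.erase c : Finset (Fin 3)) else {c}) =
        if (y : ℕ) ∈ D then 2 else 1 := by
      intro y; split_ifs <;> simp
    simp only [this]
    rw [prod_coe_sort A fun y => if y ∈ D then 2 else 1, prod_ite_mem,
      inter_eq_right.2 hDA, prod_const]
  have hle : #D ≤ 5 * n / 6 := by
    have := card_freeElts_le hA (hS hx) hx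
    rw [← hD] at this
    omega
  refine le_trans ?_ (hcard.le.trans (Nat.pow_le_pow_right (by norm_num) hle))
  refine card_le_card_of_injOn (fun f y => if (y : ℕ) ∈ D then f y else c) ?_ ?_
  · intro f hf
    simp only [mem_coe, mem_filter] at hf
    simp only [mem_coe, Fintype.mem_piFinset]
    intro y
    by_cases hy : (y : ℕ) ∈ D
    · simp only [hy, if_true, mem_erase, mem_univ, and_true]
      rw [Ne, hf.2]
      exact (mem_sdiff.1 (mem_filter.1 hy).1).2
    · simp [hy]
  · intro f hf g hg hfg
    simp only [mem_coe, mem_filter, rsf, mem_univ, true_and] at hf hg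
    have key : ∀ y, ∀ hy : y ∈ A, f ⟨y, hy⟩ = g ⟨y, hy⟩ := by
      intro y
      induction y using Nat.strong_induction_on with
      | _ y ih =>
        intro hy
        by_cases hyS : y ∈ S
        · rw [(hf.2 ⟨y, hy⟩).2 hyS, (hg.2 ⟨y, hy⟩).2 hyS]
        by_cases hyD : y ∈ D
        · have := congrFun hfg ⟨y, hy⟩
          simpa [hyD] using this
        have hex : ∃ w ∈ A \ S, w < y ∧ (w + y = x ∨ w + x = y) := by
          by_contra hcon
          exact hyD (mem_filter.2 ⟨mem_sdiff.2 ⟨hy, hyS⟩, hcon⟩)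
        obtain ⟨w, hw, hwy, hlink⟩ := hex
        obtain ⟨hwA, hwS⟩ := mem_sdiff.1 hw
        have forced : ∀ h : ↥A → Fin 3, IsRSF A h → (∀ x : ↥A, h x = c ↔ (x : ℕ) ∈ S) →
            h ⟨y, hy⟩ = h ⟨w, hwA⟩ := by
          intro h hr hc
          have hxc := (hc ⟨x, hS hx⟩).2 hx
          have hyc := (hc ⟨y, hy⟩).not.2 hyS
          have hwc := (hc ⟨w, hwA⟩).not.2 hwS
          by_contra hcon
          rcases hlink with hl | hl
          · refine hr ⟨w, hwA⟩ ⟨y, hy⟩ ⟨x, hS hx⟩ hl ⟨Ne.symm hcon, ?_, ?_⟩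
            · rwa [hxc]
            · rwa [hxc]
          · refine hr ⟨w, hwA⟩ ⟨x, hS hx⟩ ⟨y, hy⟩ hl ⟨?_, Ne.symm hcon, ?_⟩
            · rwa [hxc]
            · rw [hxc]; exact Ne.symm hyc
        rw [forced f hf.1 hf.2, forced g hg.1 hg.2, ih w hwy hwA]
    funext y
    exact key y y.2

/-! ### Containers for colorings with three large color classes -/

/-- The colored elements `(y, b)` of `Q` which are incompatible with `x` having color `a`, when
the elements of `F c` have color `c` for every `c`. -/
def killed (F : Fin 3 → Finset ℕ) (Q : Finset (ℕ × Fin 3)) (p : ℕ × Fin 3) :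
    Finset (ℕ × Fin 3) :=
  Q.filter fun q => p.2 ≠ q.2 ∧ ∃ c, c ≠ p.2 ∧ c ≠ q.2 ∧
    ∃ z ∈ F c, p.1 + q.1 = z ∨ z + q.1 = p.1

/-- The colored elements of `A` compatible with all members of `T`. -/
def remaining (A : Finset ℕ) (F : Fin 3 → Finset ℕ) (T : Finset (ℕ × Fin 3)) :
    Finset (ℕ × Fin 3) :=
  (A ×ˢ univ).filter fun q => ∀ p ∈ T, q ∉ killed F (A ×ˢ univ) p

/-- The colors still allowed at `x`: those killing fewer than `k` remaining colored elements. -/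
def palette (A : Finset ℕ) (F : Fin 3 → Finset ℕ) (k : ℕ) (T : Finset (ℕ × Fin 3)) (x : ℕ) :
    Finset (Fin 3) :=
  univ.filter fun a => (x, a) ∈ remaining A F T ∧ #(killed F (remaining A F T) (x, a)) < k

theorem exists_fingerprint {A : Finset ℕ} {f : ℕ → Fin 3}
    (hf : ∀ x ∈ A, ∀ y ∈ A, ∀ z ∈ A, x + y = z → ¬(f x ≠ f y ∧ f x ≠ f z ∧ f y ≠ f z))
    {F : Fin 3 → Finset ℕ} (hF : ∀ c, ∀ z ∈ F c, z ∈ A ∧ f z = c) {k : ℕ} (hk : 0 < k) :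
    ∃ T ⊆ A ×ˢ (univ : Finset (Fin 3)), #T * k ≤ 3 * #A ∧ ∀ x ∈ A, f x ∈ palette A F k T x := by
  classical
  let Gr : Finset (ℕ × Fin 3) := A.image fun x => (x, f x)
  let 𝒯 := Gr.powerset.filter fun T => #T * k + #(remaining A F T) ≤ 3 * #A
  have hne : 𝒯.Nonempty := by
    refine ⟨∅, mem_filter.2 ⟨by simp, ?_⟩⟩
    have : #(remaining A F ∅) ≤ #(A ×ˢ (univ : Finset (Fin 3))) := card_filter_le _ _
    rw [card_product] at this
    simp only [card_univ, Fintype.card_fin] at this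
    simp only [card_empty]
    omega
  obtain ⟨T, hT, hmax⟩ := exists_max_image 𝒯 card hne
  obtain ⟨hTG, hTc⟩ := mem_filter.1 hT
  rw [mem_powerset] at hTG
  have hGr : Gr ⊆ A ×ˢ (univ : Finset (Fin 3)) := by
    intro p hp
    obtain ⟨x, hx, rfl⟩ := mem_image.1 hp
    simpa using hx
  have hnot : ∀ x ∈ A, ∀ y ∈ A, (y, f y) ∉ killed F (A ×ˢ univ) (x, f x) := by
    intro x hx y hy h
    simp only [killed, mem_filter] at h
    obtain ⟨-, hxy, c, hcx, hcy, z, hz, hl⟩ := h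
    obtain ⟨hzA, hzc⟩ := hF c z hz
    rw [← hzc] at hcx hcy
    rcases hl with hl | hl
    · exact hf x hx y hy z hzA hl ⟨hxy, hcx.symm, hcy.symm⟩
    · exact hf z hzA y hy x hx hl ⟨hcy, hcx, hxy.symm⟩
  refine ⟨T, hTG.trans hGr, by omega, fun x hx => ?_⟩
  simp only [palette, mem_filter, mem_univ, true_and]
  refine ⟨?_, ?_⟩
  · simp only [remaining, mem_filter]
    refine ⟨by simpa using hx, fun p hp => ?_⟩
    obtain ⟨t, ht, rfl⟩ := mem_image.1 (hTG hp)
    exact hnot t ht x hx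
  · by_contra! hge
    have hsub : killed F (remaining A F T) (x, f x) ⊆ remaining A F T := filter_subset _ _
    have hxT : (x, f x) ∉ T := by
      intro hmem
      obtain ⟨q, hq⟩ := card_pos.1 (hk.trans_le hge)
      obtain ⟨hq1, hq2⟩ := mem_filter.1 hq
      obtain ⟨hq3, hq4⟩ := mem_filter.1 hq1
      exact hq4 _ hmem (mem_filter.2 ⟨hq3, hq2⟩)
    have hrem : remaining A F (insert (x, f x) T) ⊆
        remaining A F T \ killed F (remaining A F T) (x, f x) := by
      intro q hq
      obtain ⟨hq1, hq2⟩ := mem_filter.1 hq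
      refine mem_sdiff.2 ⟨mem_filter.2 ⟨hq1, fun p hp => hq2 p (mem_insert_of_mem hp)⟩, fun h => ?_⟩
      exact hq2 _ (mem_insert_self _ _) (mem_filter.2 ⟨hq1, (mem_filter.1 h).2⟩)
    have h1 := card_le_card hrem
    have h2 := card_sdiff_add_card_eq_card hsub
    have h3 := card_insert_of_notMem hxT
    have h4 : insert (x, f x) T ∈ 𝒯 := by
      refine mem_filter.2 ⟨mem_powerset.2 (insert_subset (mem_image_of_mem _ hx) hTG), ?_⟩
      rw [h3, add_mul]
      omega
    have h5 := hmax _ h4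
    omega

/-- The elements of `A` with at least two allowed colors. -/
def multi (A : Finset ℕ) (P : ℕ → Finset (Fin 3)) : Finset ℕ := A.filter fun x => 2 ≤ #(P x)

theorem card_filter_link_multi_le {A : Finset ℕ} {F : Fin 3 → Finset ℕ} {k : ℕ}
    {T : Finset (ℕ × Fin 3)} {x : ℕ} {a b c : Fin 3} (hab : a ≠ b) (hca : c ≠ a) (hcb : c ≠ b)
    (ha : a ∈ palette A F k T x) (hb : b ∈ palette A F k T x) :
    #((F c).filter fun z => ∃ y ∈ multi A (palette A F k T), x + y = z ∨ z + y = x) ≤ 4 * k := by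
  classical
  set P := palette A F k T with hP
  set Q := remaining A F T with hQ
  set Y := (killed F Q (x, a)).image Prod.fst ∪ (killed F Q (x, b)).image Prod.fst with hY
  have hYc : #Y ≤ 2 * k := by
    have h1 := card_union_le ((killed F Q (x, a)).image Prod.fst)
      ((killed F Q (x, b)).image Prod.fst)
    have h2 : #((killed F Q (x, a)).image Prod.fst) ≤ _ := card_image_le
    have h3 : #((killed F Q (x, b)).image Prod.fst) ≤ _ := card_image_le
    have h4 := (mem_filter.1 ha).2.2
    have h5 := (mem_filter.1 hb).2.2
    rw [← hY] at h1
    rw [← hQ] at h4 h5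
    omega
  have hsub : ((F c).filter fun z => ∃ y ∈ multi A P, x + y = z ∨ z + y = x) ⊆
      Y.image (fun y => x + y) ∪ Y.image fun y => x - y := by
    intro z hz
    obtain ⟨hzF, y, hy, hl⟩ := mem_filter.1 hz
    have hyY : y ∈ Y := by
      have h2 : 2 ≤ #(P y) := (mem_filter.1 hy).2
      have hex : a ∈ P y ∨ b ∈ P y := by
        by_contra! hcon
        have : P y ⊆ {c} := by
          intro d hd
          have hda : d ≠ a := fun h => hcon.1 (h ▸ hd)
          have hdb : d ≠ b := fun h => hcon.2 (h ▸ hd)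
          rw [mem_singleton]
          omega
        have := card_le_card this
        simp only [card_singleton] at this
        omega
      rw [hY, mem_union]
      rcases hex with h | h
      · refine Or.inr (mem_image.2 ⟨(y, a), mem_filter.2 ⟨(mem_filter.1 h).2.1, ?_⟩, rfl⟩)
        exact ⟨hab.symm, c, hcb, hca, z, hzF, hl⟩
      · refine Or.inl (mem_image.2 ⟨(y, b), mem_filter.2 ⟨(mem_filter.1 h).2.1, ?_⟩, rfl⟩)
        exact ⟨hab, c, hca, hcb, z, hzF, hl⟩
    rw [mem_union]
    rcases hl with hl | hl
    · exact Or.inl (mem_image.2 ⟨y, hyY, hl⟩)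
    · exact Or.inr (mem_image.2 ⟨y, hyY, by omega⟩)
  have h1 := card_le_card hsub
  have h2 := card_union_le (Y.image fun y => x + y) (Y.image fun y => x - y)
  have h3 : #(Y.image fun y => x + y) ≤ _ := card_image_le
  have h4 : #(Y.image fun y => x - y) ≤ _ := card_image_le
  omega

theorem card_multi_le {n k : ℕ} (hk : 0 < k) {A : Finset ℕ} (hA : A ⊆ Icc 1 n)
    {F : Fin 3 → Finset ℕ} (hFA : ∀ c, F c ⊆ A) (hF : ∀ c, #(F c) = 40 * k)
    (T : Finset (ℕ × Fin 3)) :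
    23 * #(multi A (palette A F k T)) ≤ 20 * n + 10 := by
  classical
  set P := palette A F k T with hP
  set B := multi A P with hB
  have hBn : B ⊆ Icc 1 n := (filter_subset _ _).trans hA
  set N := Icc 1 n \ B with hN
  have hNc : #N + #B = n := by
    rw [hN, card_sdiff_add_card_eq_card hBn]; simp
  let R : ℕ → ℕ → Prop := fun z x => ∃ y ∈ B, x + y = z ∨ z + y = x
  have hlow : ∀ x ∈ B, 36 * k ≤ ∑ c, #((F c).filter fun z => ¬R z x) := by
    intro x hx
    obtain ⟨a, ha, b, hb, hab⟩ := one_lt_card.1 (mem_filter.1 hx).2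
    obtain ⟨c, hca, hcb⟩ : ∃ c : Fin 3, c ≠ a ∧ c ≠ b := by
      clear * -
      revert a b; decide
    have h1 := card_filter_link_multi_le hab hca hcb ha hb
    have h2 := card_filter_add_card_filter_not (s := F c) fun z => R z x
    rw [hF] at h2
    have h3 : #((F c).filter fun z => ¬R z x) ≤ ∑ c, #((F c).filter fun z => ¬R z x) :=
      single_le_sum (f := fun c => #((F c).filter fun z => ¬R z x)) (fun _ _ => Nat.zero_le _)
        (mem_univ c)
    change #((F c).filter fun z => R z x) ≤ 4 * k at h1
    omega
  have hup : ∀ z ∈ Icc 1 n, #(B.filter fun x => ¬R z x) ≤ 2 * #N + 1 := by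
    intro z hz
    have hsub : (B.filter fun x => ¬R z x) ⊆
        {z} ∪ (N.image (fun w => z - w) ∪ N.image fun w => z + w) := by
      intro x hx
      obtain ⟨hxB, hxR⟩ := mem_filter.1 hx
      have hxn := mem_Icc.1 (hBn hxB)
      have hzn := mem_Icc.1 hz
      simp only [mem_union, mem_singleton, mem_image]
      rcases lt_trichotomy x z with h | h | h
      · refine Or.inr (Or.inl ⟨z - x, mem_sdiff.2 ⟨mem_Icc.2 (by omega), fun hw => hxR ?_⟩,
          by omega⟩)
        exact ⟨z - x, hw, by omega⟩
      · exact Or.inl h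
      · refine Or.inr (Or.inr ⟨x - z, mem_sdiff.2 ⟨mem_Icc.2 (by omega), fun hw => hxR ?_⟩,
          by omega⟩)
        exact ⟨x - z, hw, by omega⟩
    have h1 := card_le_card hsub
    have h2 := card_union_le {z} (N.image (fun w => z - w) ∪ N.image fun w => z + w)
    have h3 := card_union_le (N.image fun w => z - w) (N.image fun w => z + w)
    have h4 : #(N.image fun w => z - w) ≤ _ := card_image_le
    have h5 : #(N.image fun w => z + w) ≤ _ := card_image_le
    have h6 : #({z} : Finset ℕ) = 1 := card_singleton z
    omega
  have h1 : #B * (36 * k) ≤ ∑ x ∈ B, ∑ c, #((F c).filter fun z => ¬R z x) := by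
    rw [← smul_eq_mul]
    exact card_nsmul_le_sum _ _ _ hlow
  have h2 : ∑ x ∈ B, ∑ c, #((F c).filter fun z => ¬R z x) =
      ∑ c, ∑ z ∈ F c, #(B.filter fun x => ¬R z x) := by
    rw [sum_comm]
    refine sum_congr rfl fun c _ => ?_
    exact sum_card_bipartiteAbove_eq_sum_card_bipartiteBelow fun x z => ¬R z x
  have h3 : ∑ c, ∑ z ∈ F c, #(B.filter fun x => ¬R z x) ≤
      ∑ c : Fin 3, 40 * k * (2 * #N + 1) := by
    refine sum_le_sum fun c _ => ?_
    rw [← hF c, ← smul_eq_mul]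
    exact sum_le_card_nsmul _ _ _ fun z hz => hup z (hA (hFA c hz))
  rw [h2] at h1
  have h4 := h1.trans h3
  simp only [sum_const, card_univ, Fintype.card_fin, smul_eq_mul] at h4
  have h5 : (12 * k) * (3 * #B) ≤ (12 * k) * (10 * (2 * #N + 1)) := by linarith
  have h6 := Nat.le_of_mul_le_mul_left h5 (by omega)
  omega

/-- The elements of `A` with all three colors allowed. -/
def full (A : Finset ℕ) (P : ℕ → Finset (Fin 3)) : Finset ℕ := A.filter fun x => #(P x) = 3

theorem card_full_add_card_multi_le {n k : ℕ} (hk : 0 < k) {A : Finset ℕ} (hA : A ⊆ Icc 1 n)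
    {F : Fin 3 → Finset ℕ} (hFA : ∀ c, F c ⊆ A) (hF : ∀ c, #(F c) = 40 * k) {c : Fin 3}
    (hc : ∀ z ∈ F c, #(A.filter fun x => z ≤ x) ≤ 120 * k) (T : Finset (ℕ × Fin 3)) :
    9 * #(full A (palette A F k T)) + 10 * #(multi A (palette A F k T)) ≤ 10 * n + 1200 * k := by
  classical
  set P := palette A F k T with hP
  set B := multi A P with hB
  set X := full A P with hX
  have hBn : B ⊆ Icc 1 n := (filter_subset _ _).trans hA
  have hXA : X ⊆ A := filter_subset _ _
  set N := Icc 1 n \ B with hN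
  have hNc : #N + #B = n := by
    rw [hN, card_sdiff_add_card_eq_card hBn]; simp
  let R : ℕ → ℕ → Prop := fun z x => ∃ y ∈ B, x + y = z ∨ z + y = x
  have hup : ∀ x ∈ X, #((F c).filter fun z => R z x) ≤ 4 * k := by
    intro x hx
    have hPx : P x = univ := by
      rw [← card_eq_iff_eq_univ, (mem_filter.1 hx).2, Fintype.card_fin]
    obtain ⟨a, b, hab, hca, hcb⟩ : ∃ a b : Fin 3, a ≠ b ∧ c ≠ a ∧ c ≠ b := by
      clear * -
      revert c; decide
    exact card_filter_link_multi_le hab hca hcb (by rw [← hP, hPx]; exact mem_univ _)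
      (by rw [← hP, hPx]; exact mem_univ _)
  have hlow : ∀ z ∈ F c, #X ≤ #(X.filter fun x => R z x) + (120 * k + #N) := by
    intro z hz
    have hzn := mem_Icc.1 (hA (hFA c hz))
    have hsub : X ⊆ (X.filter fun x => R z x) ∪
        ((A.filter fun x => z ≤ x) ∪ N.image fun w => z - w) := by
      intro x hx
      have hxn := mem_Icc.1 (hA (hXA hx))
      simp only [mem_union, mem_filter, mem_image]
      by_cases h : R z x
      · exact Or.inl ⟨hx, h⟩
      · right
        rcases le_or_gt z x with hzx | hzx
        · exact Or.inl ⟨hXA hx, hzx⟩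
        · refine Or.inr ⟨z - x, mem_sdiff.2 ⟨mem_Icc.2 (by omega), fun hw => h ?_⟩, by omega⟩
          exact ⟨z - x, hw, by omega⟩
    have h1 := card_le_card hsub
    have h2 := card_union_le (X.filter fun x => R z x)
      ((A.filter fun x => z ≤ x) ∪ N.image fun w => z - w)
    have h3 := card_union_le (A.filter fun x => z ≤ x) (N.image fun w => z - w)
    have h4 : #(N.image fun w => z - w) ≤ _ := card_image_le
    have h5 := hc z hz
    omega
  have h1 : ∑ z ∈ F c, #(X.filter fun x => R z x) = ∑ x ∈ X, #((F c).filter fun z => R z x) :=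
    sum_card_bipartiteAbove_eq_sum_card_bipartiteBelow fun z x => R z x
  have h2 : ∑ x ∈ X, #((F c).filter fun z => R z x) ≤ #X * (4 * k) := by
    rw [← smul_eq_mul]
    exact sum_le_card_nsmul _ _ _ hup
  have h3 : #(F c) * #X ≤ ∑ z ∈ F c, (#(X.filter fun x => R z x) + (120 * k + #N)) := by
    rw [← smul_eq_mul]
    exact card_nsmul_le_sum _ _ _ hlow
  rw [sum_add_distrib, h1, sum_const, smul_eq_mul, hF] at h3
  have h4 : (4 * k) * (10 * #X) ≤ (4 * k) * (#X + 10 * (120 * k + #N)) := by linarith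
  have h5 := Nat.le_of_mul_le_mul_left h4 (by omega)
  omega

set_option exponentiation.threshold 400 in
theorem prod_card_palette_le {n k : ℕ} (hk : 0 < k) {A : Finset ℕ} (hA : A ⊆ Icc 1 n)
    {F : Fin 3 → Finset ℕ} (hFA : ∀ c, F c ⊆ A) (hF : ∀ c, #(F c) = 40 * k)
    (hc : ∃ c, ∀ z ∈ F c, #(A.filter fun x => z ≤ x) ≤ 120 * k) (T : Finset (ℕ × Fin 3)) :
    ∏ x ∈ A, #(palette A F k T x) ≤ 2 ^ ((330 * n + 27600 * k + 50) / 345 + 1) := by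
  obtain ⟨c, hc⟩ := hc
  have h1 := card_multi_le hk hA hFA hF T
  have h2 := card_full_add_card_multi_le hk hA hFA hF hc T
  set P := palette A F k T with hP
  have h3 : (∏ x ∈ A, #(P x)) ^ 5 ≤ 2 ^ (5 * #(multi A P) + 3 * #(full A P)) := by
    have hexp : 5 * #(multi A P) + 3 * #(full A P) =
        ∑ x ∈ A, ((if 2 ≤ #(P x) then 5 else 0) + if #(P x) = 3 then 3 else 0) := by
      rw [sum_add_distrib, ← sum_filter, ← sum_filter, sum_const, sum_const]
      simp only [multi, full, smul_eq_mul]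
      ring
    rw [hexp, ← prod_pow_eq_pow_sum, ← prod_pow]
    refine prod_le_prod' fun x _ => ?_
    have h : #(P x) ≤ 3 := (card_le_univ _).trans (by simp)
    interval_cases #(P x) <;> simp
  have h4 : ((∏ x ∈ A, #(P x)) ^ 5) ^ 69 ≤ (2 ^ (5 * #(multi A P) + 3 * #(full A P))) ^ 69 :=
    Nat.pow_le_pow_left h3 _
  rw [← pow_mul, ← pow_mul] at h4
  rw [← Nat.pow_le_pow_iff_left (n := 345) (by norm_num)]
  refine h4.trans ?_
  rw [← pow_mul]
  refine Nat.pow_le_pow_right (by norm_num) ?_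
  omega

theorem exists_top_subset (A : Finset ℕ) (j : ℕ) (hj : j ≤ #A) :
    ∃ W ⊆ A, #W = j ∧ ∀ z ∈ W, #(A.filter fun x => z ≤ x) ≤ j := by
  classical
  suffices h : ∃ W ⊆ A, #W = j ∧ ∀ z ∈ W, ∀ x ∈ A, z ≤ x → x ∈ W by
    obtain ⟨W, hWA, hW, h⟩ := h
    refine ⟨W, hWA, hW, fun z hz => hW ▸ card_le_card fun x hx => ?_⟩
    exact h z hz x (mem_filter.1 hx).1 (mem_filter.1 hx).2
  induction j with
  | zero => exact ⟨∅, by simp⟩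
  | succ j ih =>
    obtain ⟨W, hWA, hW, h⟩ := ih (by omega)
    have hne : (A \ W).Nonempty := by
      rw [← card_pos]
      have := card_sdiff_add_card_eq_card hWA
      omega
    have hm := max'_mem _ hne
    obtain ⟨hmA, hmW⟩ := mem_sdiff.1 hm
    refine ⟨insert ((A \ W).max' hne) W, insert_subset hmA hWA, ?_, ?_⟩
    · rw [card_insert_of_notMem hmW, hW]
    · intro z hz x hx hzx
      by_cases hxW : x ∈ W
      · exact mem_insert_of_mem hxW
      rcases mem_insert.1 hz with rfl | hz
      · have := le_max' _ x (mem_sdiff.2 ⟨hx, hxW⟩)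
        rw [mem_insert]
        exact Or.inl (le_antisymm this hzx)
      · exact absurd (h z hz x hx hzx) hxW

theorem exists_classes {A : Finset ℕ} {f : ℕ → Fin 3} {k : ℕ}
    (hf : ∀ c, 40 * k ≤ #(A.filter fun x => f x = c)) :
    ∃ F : Fin 3 → Finset ℕ, (∀ c, ∀ z ∈ F c, z ∈ A ∧ f z = c) ∧ (∀ c, #(F c) = 40 * k) ∧
      ∃ c, ∀ z ∈ F c, #(A.filter fun x => z ≤ x) ≤ 120 * k := by
  classical
  have hA : 120 * k ≤ #A := by
    have h1 : #A = ∑ c, #(A.filter fun x => f x = c) :=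
      card_eq_sum_card_fiberwise fun _ _ => mem_coe.2 (mem_univ _)
    have h2 : ∑ _c : Fin 3, 40 * k ≤ ∑ c, #(A.filter fun x => f x = c) :=
      sum_le_sum fun c _ => hf c
    simp only [sum_const, card_univ, Fintype.card_fin, smul_eq_mul] at h2
    omega
  obtain ⟨W, hWA, hW, htop⟩ := exists_top_subset A (120 * k) hA
  obtain ⟨c₀, -, hc₀⟩ := exists_le_card_fiber_of_mul_le_card_of_maps_to
    (s := W) (t := (univ : Finset (Fin 3))) (f := f) (n := 40 * k) (fun _ _ => mem_univ _)
    ⟨0, mem_univ _⟩ (by simp only [card_univ, Fintype.card_fin]; omega)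
  obtain ⟨F₀, hF₀, hF₀c⟩ := exists_subset_card_eq hc₀
  choose G hG hGc using fun c => exists_subset_card_eq (hf c)
  refine ⟨fun c => if c = c₀ then F₀ else G c, ?_, ?_, c₀, ?_⟩
  · intro c z hz
    dsimp only at hz
    split_ifs at hz with h
    · have := mem_filter.1 (hF₀ hz)
      exact ⟨hWA this.1, h ▸ this.2⟩
    · exact mem_filter.1 (hG c hz)
  · intro c
    dsimp only
    split_ifs
    · exact hF₀c
    · exact hGc c
  · intro z hz
    simp only [if_true] at hz
    exact htop z (mem_filter.1 (hF₀ hz)).1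

open Classical in
theorem card_rsf_filter_large_classes_le {n k M : ℕ} (hk : 0 < k) (hM : ∀ t, t * k ≤ 3 * n → t ≤ M)
    {A : Finset ℕ} (hA : A ⊆ Icc 1 n) :
    #((rsf A).filter fun f => ∀ c, 40 * k ≤ #(univ.filter fun x => f x = c)) ≤
      (3 * n + 1) ^ (120 * k + M) * 2 ^ ((330 * n + 27600 * k + 50) / 345 + 1) := by
  have hAn : #A ≤ n := (card_le_card hA).trans (by simp)
  let 𝓕 : Finset (Fin 3 → Finset ℕ) := (Fintype.piFinset fun _ => A.powersetCard (40 * k)).filter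
    fun F => ∃ c, ∀ z ∈ F c, #(A.filter fun x => z ≤ x) ≤ 120 * k
  let 𝓣 : Finset (Finset (ℕ × Fin 3)) := (A ×ˢ univ).powerset.filter fun T => #T ≤ M
  have hsub : ((rsf A).filter fun f => ∀ c, 40 * k ≤ #(univ.filter fun x => f x = c)) ⊆
      (𝓕 ×ˢ 𝓣).biUnion fun p => Fintype.piFinset fun x : ↥A => palette A p.1 k p.2 x := by
    intro f hf
    obtain ⟨hr, hcl⟩ := mem_filter.1 hf
    have hr : IsRSF A f := (mem_filter.1 hr).2
    let g : ℕ → Fin 3 := fun x => if h : x ∈ A then f ⟨x, h⟩ else 0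
    have hg : ∀ x (h : x ∈ A), g x = f ⟨x, h⟩ := fun x h => by simp [g, h]
    have hgr : ∀ x ∈ A, ∀ y ∈ A, ∀ z ∈ A, x + y = z →
        ¬(g x ≠ g y ∧ g x ≠ g z ∧ g y ≠ g z) := by
      intro x hx y hy z hz h
      rw [hg x hx, hg y hy, hg z hz]
      exact hr ⟨x, hx⟩ ⟨y, hy⟩ ⟨z, hz⟩ h
    have hgcl : ∀ c, 40 * k ≤ #(A.filter fun x => g x = c) := by
      intro c
      refine (hcl c).trans (card_le_card_of_injOn Subtype.val ?_ Subtype.val_injective.injOn)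
      intro x hx
      simp only [coe_filter, mem_univ, true_and, Set.mem_ofPred_eq] at hx ⊢
      exact ⟨x.2, (hg x x.2).trans hx⟩
    obtain ⟨F, hF, hFc, hFt⟩ := exists_classes hgcl
    obtain ⟨T, hTA, hT, hP⟩ := exists_fingerprint hgr hF hk
    rw [mem_biUnion]
    refine ⟨(F, T), mem_product.2 ⟨mem_filter.2 ⟨?_, hFt⟩, mem_filter.2 ⟨mem_powerset.2 hTA, ?_⟩⟩,
      ?_⟩
    · rw [Fintype.mem_piFinset]
      exact fun c => mem_powersetCard.2 ⟨fun z hz => (hF c z hz).1, hFc c⟩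
    · exact hM _ (hT.trans (by omega))
    · rw [Fintype.mem_piFinset]
      intro x
      rw [← hg x x.2]
      exact hP x x.2
  have hprod : ∀ p ∈ 𝓕 ×ˢ 𝓣, #(Fintype.piFinset fun x : ↥A => palette A p.1 k p.2 x) ≤
      2 ^ ((330 * n + 27600 * k + 50) / 345 + 1) := by
    intro p hp
    obtain ⟨hF, hFt⟩ := mem_filter.1 (mem_product.1 hp).1
    rw [Fintype.mem_piFinset] at hF
    rw [Fintype.card_piFinset, prod_coe_sort A fun x => #(palette A p.1 k p.2 x)]
    exact prod_card_palette_le hk hA (fun c => (mem_powersetCard.1 (hF c)).1)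
      (fun c => (mem_powersetCard.1 (hF c)).2) hFt p.2
  have h𝓕 : #𝓕 ≤ (3 * n + 1) ^ (120 * k) := by
    refine (card_filter_le _ _).trans ?_
    rw [Fintype.card_piFinset, prod_const, card_powersetCard, card_univ, Fintype.card_fin]
    calc (#A).choose (40 * k) ^ 3 ≤ ((3 * n + 1) ^ (40 * k)) ^ 3 := by
          refine Nat.pow_le_pow_left ((Nat.choose_le_pow _ _).trans ?_) _
          exact Nat.pow_le_pow_left (by omega) _
      _ = (3 * n + 1) ^ (120 * k) := by rw [← pow_mul]; congr 1; ring
  have h𝓣 : #𝓣 ≤ (3 * n + 1) ^ M := by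
    refine (card_filter_powerset_card_le _ _).trans (Nat.pow_le_pow_left ?_ _)
    rw [card_product, card_univ, Fintype.card_fin]
    omega
  calc _ ≤ _ := card_le_card hsub
    _ ≤ #(𝓕 ×ˢ 𝓣) * _ := card_biUnion_le_card_mul _ _ _ hprod
    _ ≤ _ := by
      rw [card_product, pow_add (3 * n + 1)]
      exact Nat.mul_le_mul_right _ (Nat.mul_le_mul h𝓕 h𝓣)

open Classical in
theorem card_rsf_filter_small_class_le {n K : ℕ} {A : Finset ℕ} (hA : A ⊆ Icc 1 n) :
    #((rsf A).filter fun f => ∃ c, (univ.filter fun x => f x = c).Nonempty ∧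
      #(univ.filter fun x => f x = c) ≤ K) ≤ 3 * (3 * n + 1) ^ K * 2 ^ (5 * n / 6) := by
  have hAn : #A ≤ n := (card_le_card hA).trans (by simp)
  let 𝓢 : Finset (Finset ℕ) := (A.powerset.filter fun S => #S ≤ K).filter Finset.Nonempty
  have hsub : ((rsf A).filter fun f => ∃ c, (univ.filter fun x => f x = c).Nonempty ∧
      #(univ.filter fun x => f x = c) ≤ K) ⊆ ((univ : Finset (Fin 3)) ×ˢ 𝓢).biUnion fun p =>
        (rsf A).filter fun f => ∀ x : ↥A, f x = p.1 ↔ (x : ℕ) ∈ p.2 := by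
    intro f hf
    obtain ⟨hr, c, hne, hc⟩ := mem_filter.1 hf
    rw [mem_biUnion]
    refine ⟨(c, (univ.filter fun x => f x = c).image Subtype.val), ?_, ?_⟩
    · refine mem_product.2 ⟨mem_univ _, mem_filter.2 ⟨mem_filter.2 ⟨mem_powerset.2 ?_, ?_⟩, ?_⟩⟩
      · intro x hx
        obtain ⟨y, -, rfl⟩ := mem_image.1 hx
        exact y.2
      · exact card_image_le.trans hc
      · exact hne.image _
    · refine mem_filter.2 ⟨hr, fun x => ?_⟩
      simp
  have hfib : ∀ p ∈ (univ : Finset (Fin 3)) ×ˢ 𝓢,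
      #((rsf A).filter fun f => ∀ x : ↥A, f x = p.1 ↔ (x : ℕ) ∈ p.2) ≤ 2 ^ (5 * n / 6) := by
    intro p hp
    obtain ⟨h1, h2⟩ := mem_filter.1 (mem_product.1 hp).2
    exact card_rsf_filter_class_eq_le hA (mem_powerset.1 (mem_filter.1 h1).1) h2 p.1
  have h𝓢 : #𝓢 ≤ (3 * n + 1) ^ K := by
    refine (card_filter_le _ _).trans ((card_filter_powerset_card_le _ _).trans ?_)
    exact Nat.pow_le_pow_left (by omega) _
  calc _ ≤ _ := card_le_card hsub
    _ ≤ #((univ : Finset (Fin 3)) ×ˢ 𝓢) * _ := card_biUnion_le_card_mul _ _ _ hfib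
    _ ≤ _ := by
      rw [card_product, card_univ, Fintype.card_fin]
      exact Nat.mul_le_mul_right _ (Nat.mul_le_mul_left _ h𝓢)

theorem card_rsf_le {n k M : ℕ} (hk : 0 < k) (hM : ∀ t, t * k ≤ 3 * n → t ≤ M)
    {A : Finset ℕ} (hA : A ⊆ Icc 1 n) :
    #(rsf A) ≤ 3 * 2 ^ #A + 3 * (3 * n + 1) ^ (40 * k) * 2 ^ (5 * n / 6) +
      (3 * n + 1) ^ (120 * k + M) * 2 ^ ((330 * n + 27600 * k + 50) / 345 + 1) := by
  classical
  let E : Finset (↥A → Fin 3) := (univ : Finset (Fin 3)).biUnion fun c =>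
    Fintype.piFinset fun _ => univ.erase c
  have hE : #E ≤ 3 * 2 ^ #A := by
    refine (card_biUnion_le_card_mul _ _ (2 ^ #A) fun c _ => ?_).trans ?_
    · simp [Fintype.card_piFinset]
    · simp
  have hsub : rsf A ⊆ E ∪ ((rsf A).filter fun f => ∃ c, (univ.filter fun x => f x = c).Nonempty ∧
      #(univ.filter fun x => f x = c) ≤ 40 * k) ∪
      (rsf A).filter fun f => ∀ c, 40 * k ≤ #(univ.filter fun x => f x = c) := by
    intro f hf
    rw [mem_union, mem_union, mem_filter, mem_filter]
    by_cases h1 : ∀ c, 40 * k ≤ #(univ.filter fun x => f x = c)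
    · exact Or.inr ⟨hf, h1⟩
    push Not at h1
    obtain ⟨c, hc⟩ := h1
    left
    rcases (univ.filter fun x => f x = c).eq_empty_or_nonempty with h | h
    · refine Or.inl (mem_biUnion.2 ⟨c, mem_univ _, ?_⟩)
      rw [Fintype.mem_piFinset]
      intro x
      exact mem_erase.2 ⟨(filter_eq_empty_iff.1 h) (mem_univ x), mem_univ _⟩
    · exact Or.inr ⟨hf, c, h, hc.le⟩
  refine (card_le_card hsub).trans ((card_union_le _ _).trans (Nat.add_le_add
    ((card_union_le _ _).trans (Nat.add_le_add hE ?_)) ?_))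
  · exact card_rsf_filter_small_class_le hA
  · exact card_rsf_filter_large_classes_le hk hM hA

theorem error_terms_le {n : ℕ} (hn : 20000 ^ 4 < n) :
    4 * (3 * (3 * n + 1) ^ (40 * n.sqrt) * 2 ^ (5 * n / 6) +
      (3 * n + 1) ^ (120 * n.sqrt + 9 * n.sqrt) *
        2 ^ ((330 * n + 27600 * n.sqrt + 50) / 345 + 1)) ≤ 2 ^ n := by
  obtain ⟨k, hk⟩ : ∃ k, k = n.sqrt := ⟨_, rfl⟩
  obtain ⟨m, hm⟩ : ∃ m, m = k.sqrt := ⟨_, rfl⟩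
  rw [← hk]
  have hk1 : k * k ≤ n := hk ▸ Nat.sqrt_le n
  have hk2 : n < (k + 1) * (k + 1) := hk ▸ Nat.lt_succ_sqrt n
  have hm1 : m * m ≤ k := hm ▸ Nat.sqrt_le k
  have hm2 : k < (m + 1) * (m + 1) := hm ▸ Nat.lt_succ_sqrt k
  have hk3 : 20000 ^ 2 ≤ k := by
    rw [hk, Nat.le_sqrt]; norm_num at hn ⊢; omega
  have hm3 : 20000 ≤ m := by
    rw [hm, Nat.le_sqrt]; norm_num at hk3 ⊢; omega
  set E := (330 * n + 27600 * k + 50) / 345 + 1 with hE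
  have hN : 3 * n + 1 ≤ 2 ^ (4 * m + 2) := by
    have h1 : m + 1 ≤ 2 ^ m := Nat.lt_two_pow_self
    have h2 : k + 1 ≤ 2 ^ m * 2 ^ m := by
      have := Nat.mul_le_mul h1 h1
      omega
    have h3 : n + 1 ≤ (2 ^ m * 2 ^ m) * (2 ^ m * 2 ^ m) := by
      have := Nat.mul_le_mul h2 h2
      omega
    have h4 : 2 ^ (4 * m + 2) = 4 * ((2 ^ m * 2 ^ m) * (2 ^ m * 2 ^ m)) := by
      rw [pow_add, pow_mul']; ring
    omega
  have h1 : 3 * (3 * n + 1) ^ (40 * k) * 2 ^ (5 * n / 6) ≤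
      3 * ((3 * n + 1) ^ (120 * k + 9 * k) * 2 ^ E) := by
    rw [mul_assoc]
    refine Nat.mul_le_mul_left _ (Nat.mul_le_mul ?_ ?_)
    · exact Nat.pow_le_pow_right (by omega) (by omega)
    · exact Nat.pow_le_pow_right (by norm_num) (by omega)
  have h2 : (3 * n + 1) ^ (120 * k + 9 * k) ≤ 2 ^ ((4 * m + 2) * (129 * k)) := by
    rw [pow_mul, show 120 * k + 9 * k = 129 * k by ring]
    exact Nat.pow_le_pow_left hN _
  have h3 : 4 + ((4 * m + 2) * (129 * k) + E) ≤ n := by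
    have h5 : 23 * (129 * (4 * m + 2) + 80 + 1) ≤ k := by nlinarith
    have h6 : 23 * (129 * (4 * m + 2) + 80 + 1) * k ≤ n := (Nat.mul_le_mul_right k h5).trans hk1
    have h7 : (4 * m + 2) * (129 * k) = 129 * (4 * m + 2) * k := by ring
    have h8 : 23 * (129 * (4 * m + 2) + 80 + 1) * k =
        23 * (129 * (4 * m + 2) * k) + 23 * 81 * k := by ring
    omega
  calc _ ≤ 4 * (3 * ((3 * n + 1) ^ (120 * k + 9 * k) * 2 ^ E) +
        (3 * n + 1) ^ (120 * k + 9 * k) * 2 ^ E) := by omega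
    _ = 2 ^ 4 * ((3 * n + 1) ^ (120 * k + 9 * k) * 2 ^ E) := by ring
    _ ≤ 2 ^ 4 * (2 ^ ((4 * m + 2) * (129 * k)) * 2 ^ E) := by gcongr
    _ = 2 ^ (4 + ((4 * m + 2) * (129 * k) + E)) := by rw [← pow_add, ← pow_add]
    _ ≤ 2 ^ n := Nat.pow_le_pow_right (by norm_num) h3

theorem numRSF_three_lt {n : ℕ} (hn : 20000 ^ 4 < n) {A : Finset ℕ} (hA : A ⊆ Icc 1 n)
    (hne : A ≠ Icc 1 n) : numRSF 3 A < numRSF 3 (Icc 1 n) := by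
  rw [numRSF_three_eq_card_rsf, numRSF_three_eq_card_rsf]
  have hk : 0 < n.sqrt := Nat.sqrt_pos.2 (by omega)
  have hM : ∀ t, t * n.sqrt ≤ 3 * n → t ≤ 9 * n.sqrt := by
    intro t ht
    have h1 : n < (n.sqrt + 1) * (n.sqrt + 1) := Nat.lt_succ_sqrt n
    by_contra! hlt
    nlinarith
  have h1 := card_rsf_le hk hM hA
  have h2 := error_terms_le hn
  have h3 := two_mul_two_pow_le_card_rsf_Icc n
  have h4 : #A + 1 ≤ n := by
    have := card_lt_card (hA.ssubset_of_ne hne)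
    simpa using this
  have h5 : 2 * 2 ^ #A ≤ 2 ^ n := by
    rw [← pow_succ']
    exact Nat.pow_le_pow_right (by norm_num) h4
  have h6 : n < 2 ^ n := Nat.lt_two_pow_self
  have h7 : 20000 ^ 4 < 2 ^ n := hn.trans h6
  omega

end Auxiliary

theorem stmt_2 :
    ∃ n₀ : ℕ, ∀ n : ℕ, n₀ < n →
      (∀ A ⊆ Finset.Icc 1 n, numRSF 3 A ≤ numRSF 3 (Finset.Icc 1 n)) ∧
      (∀ A ⊆ Finset.Icc 1 n, A ≠ Finset.Icc 1 n →
        numRSF 3 A < numRSF 3 (Finset.Icc 1 n)) := by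
  refine ⟨20000 ^ 4, fun n hn => ⟨fun A hA => ?_, fun A hA hne => numRSF_three_lt hn hA hne⟩⟩
  rcases eq_or_ne A (Icc 1 n) with rfl | hne
  · exact le_rfl
  · exact (numRSF_three_lt hn hA hne).le
end
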